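/- arXiv:1809.05737 — 4 statements merged into one kernel-verified Lean document; each statement's English description precedes it below -/
import Mathlib

section
/- Let n ≥ 1 and let f : ℝⁿ → ℝ be a positive C² function with Δf ≥ 0 everywhere (so that Δf/f ≥ 0, i.e. f is a positive subharmonic function on the complete noncompact Riemannian manifold ℝⁿ). If there exist a real number q > 1 and a point x₀ ∈ ℝⁿ such that liminf_{r→∞} (1/r²) ∫_{B(x₀;r)} f^q dx < ∞ (i.e. f has 2-finite growth with respect to q), then f is constant. -/
open MeasureTheory Filter

/-- The Laplacian of `f : ℝⁿ → ℝ`, defined as the trace of the Hessian. -/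
noncomputable def euclideanLaplacian {n : ℕ} (f : EuclideanSpace ℝ (Fin n) → ℝ)
    (x : EuclideanSpace ℝ (Fin n)) : ℝ :=
  ∑ i : Fin n,
    iteratedFDeriv ℝ 2 f x ![EuclideanSpace.single i 1, EuclideanSpace.single i 1]

/-- Cutoff functions adapted to the balls `B(x₀; r / 2) ⊆ B(x₀; r)`, with gradient of size
`O(1 / r)` uniformly in the center and the radius. -/
theorem exists_cutoff_gradient_le (n : ℕ) :
    ∃ C : ℝ, 0 ≤ C ∧ ∀ (x₀ : EuclideanSpace ℝ (Fin n)) (r : ℝ), 0 < r →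
      ∃ η : EuclideanSpace ℝ (Fin n) → ℝ, ContDiff ℝ 1 η ∧ HasCompactSupport η ∧
        (∀ x, 0 ≤ η x) ∧ (∀ x, η x ≤ 1) ∧
        (∀ x ∈ Metric.ball x₀ (r / 2), η x = 1) ∧ (∀ x ∉ Metric.ball x₀ r, η x = 0) ∧
        ∀ x, ∑ i, fderiv ℝ η x (EuclideanSpace.single i 1) ^ 2 ≤ C / r ^ 2 := by
  let χ : ContDiffBump (0 : EuclideanSpace ℝ (Fin n)) := ⟨1 / 2, 1, by norm_num, by norm_num⟩
  have hχ : ContDiff ℝ 1 χ := χ.contDiff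
  obtain ⟨C, hC⟩ := (χ.hasCompactSupport.fderiv (𝕜 := ℝ)).exists_bound_of_continuous
    (hχ.continuous_fderiv one_ne_zero)
  refine ⟨n * C ^ 2, by positivity, fun x₀ r hr => ?_⟩
  have hzero : ∀ x ∉ Metric.ball x₀ r, χ (r⁻¹ • (x - x₀)) = 0 := fun x hx => by
    apply χ.zero_of_le_dist
    rw [Metric.mem_ball, not_lt, dist_eq_norm] at hx
    rw [dist_zero_right, norm_smul, norm_inv, Real.norm_of_nonneg hr.le, inv_mul_eq_div]
    exact (one_le_div hr).2 hx
  refine ⟨fun x => χ (r⁻¹ • (x - x₀)), by fun_prop, ?_, fun x => χ.nonneg, fun x => χ.le_one,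
    fun x hx => ?_, hzero, fun x => ?_⟩
  · exact HasCompactSupport.intro (isCompact_closedBall x₀ r)
      fun x hx => hzero x fun h => hx (Metric.ball_subset_closedBall h)
  · apply χ.one_of_mem_closedBall
    rw [Metric.mem_ball, dist_eq_norm] at hx
    rw [mem_closedBall_zero_iff, norm_smul, norm_inv, Real.norm_of_nonneg hr.le, inv_mul_eq_div]
    change _ ≤ (1 / 2 : ℝ)
    rw [div_le_iff₀ hr]
    linarith
  · have hd : HasFDerivAt (fun x => χ (r⁻¹ • (x - x₀)))
        ((fderiv ℝ χ (r⁻¹ • (x - x₀))).comp (r⁻¹ • ContinuousLinearMap.id ℝ _)) x := by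
      apply HasFDerivAt.comp x (hχ.differentiable one_ne_zero _).hasFDerivAt
      exact ((hasFDerivAt_id x).sub_const x₀).const_smul r⁻¹
    rw [hd.fderiv]
    have hi : ∀ i : Fin n, ((fderiv ℝ χ (r⁻¹ • (x - x₀))).comp
        (r⁻¹ • ContinuousLinearMap.id ℝ _) (EuclideanSpace.single i 1)) ^ 2 ≤ C ^ 2 / r ^ 2 := by
      intro i
      have h := (fderiv ℝ χ (r⁻¹ • (x - x₀))).le_of_opNorm_le (hC _)
        (EuclideanSpace.single i (1 : ℝ))
      simp only [PiLp.norm_single, norm_one, mul_one, Real.norm_eq_abs] at h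
      have h2 := sq_le_sq' (abs_le.1 h).1 (abs_le.1 h).2
      simp only [ContinuousLinearMap.comp_apply, _root_.smul_apply,
        ContinuousLinearMap.id_apply, map_smul, smul_eq_mul, mul_pow, inv_pow]
      rw [inv_mul_eq_div]
      gcongr
    calc _ ≤ ∑ _i : Fin n, C ^ 2 / r ^ 2 := Finset.sum_le_sum fun i _ => hi i
      _ = n * C ^ 2 / r ^ 2 := by simp [mul_div_assoc]

/-- The integral of a directional derivative of a compactly supported `C¹` function vanishes. -/
theorem integral_fderiv_apply_eq_zero {n : ℕ} {g : EuclideanSpace ℝ (Fin n) → ℝ}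
    (hg : ContDiff ℝ 1 g) (hc : HasCompactSupport g) (v : EuclideanSpace ℝ (Fin n)) :
    ∫ x, fderiv ℝ g x v = 0 := by
  have hi : Integrable (fun x => fderiv ℝ g x v) :=
    ((hg.continuous_fderiv one_ne_zero).clm_apply continuous_const).integrable_of_hasCompactSupport
      (hc.fderiv_apply (𝕜 := ℝ) v)
  have h := integral_mul_fderiv_eq_neg_fderiv_mul_of_integrable (μ := volume) (𝕜 := ℝ)
    (f := fun _ : EuclideanSpace ℝ (Fin n) => (1 : ℝ)) (g := g) (v := v)
    (by simp) (by simpa using hi)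
    (by simpa using hg.continuous.integrable_of_hasCompactSupport hc)
    (fun x _ => differentiableAt_const _) (fun x _ => hg.differentiable one_ne_zero x)
  simpa using h

/-- Testing `0 ≤ Δf` against `η² f^(q-1)` and integrating by parts. -/
theorem integral_energy_le_integral_cross {n : ℕ} {f : EuclideanSpace ℝ (Fin n) → ℝ}
    (hf_pos : ∀ x, 0 < f x) (hf_C2 : ContDiff ℝ 2 f)
    (hf_sub : ∀ x, 0 ≤ euclideanLaplacian f x) (q : ℝ)
    {η : EuclideanSpace ℝ (Fin n) → ℝ} (hη : ContDiff ℝ 1 η) (hc : HasCompactSupport η) :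
    (q - 1) * ∫ x, η x ^ 2 *
        (f x ^ (q - 2) * ∑ i, fderiv ℝ f x (EuclideanSpace.single i 1) ^ 2) ≤
      ∫ x, -(2 * (η x * f x ^ (q - 1) * ∑ i, fderiv ℝ η x (EuclideanSpace.single i 1) *
        fderiv ℝ f x (EuclideanSpace.single i 1))) := by
  have hfne : ∀ x, f x ≠ 0 := fun x => (hf_pos x).ne'
  have hf1 : ContDiff ℝ 1 f := hf_C2.of_le (by norm_num)
  have hdf : ContDiff ℝ 1 (fderiv ℝ f) := hf_C2.fderiv_right (by norm_num)
  have hpow : ∀ p : ℝ, ContDiff ℝ 1 (fun x => f x ^ p) := fun p => hf1.rpow_const_of_ne hfne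
  have hpc : ∀ p : ℝ, Continuous (fun x => f x ^ p) := fun p => (hpow p).continuous
  have hηc := hη.continuous
  have hdηc := hη.continuous_fderiv one_ne_zero
  have hdfc := hdf.continuous
  have hddfc := hdf.continuous_fderiv one_ne_zero
  let W : Fin n → EuclideanSpace ℝ (Fin n) → ℝ := fun i x =>
    η x ^ 2 * f x ^ (q - 1) * fderiv ℝ f x (EuclideanSpace.single i 1)
  have hW : ∀ i, ContDiff ℝ 1 (W i) := fun i =>
    ((hη.pow 2).mul (hpow _)).mul (hdf.clm_apply contDiff_const)
  have hWc : ∀ i, HasCompactSupport (W i) := fun i =>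
    hc.mono fun x hx => by
      contrapose! hx
      simp only [Function.mem_support, not_not] at hx ⊢
      simp [W, hx]
  have hWd : ∀ i x, fderiv ℝ (W i) x (EuclideanSpace.single i 1) =
      2 * (η x * f x ^ (q - 1) * (fderiv ℝ η x (EuclideanSpace.single i 1) *
        fderiv ℝ f x (EuclideanSpace.single i 1))) +
      (q - 1) * (η x ^ 2 * (f x ^ (q - 2) * fderiv ℝ f x (EuclideanSpace.single i 1) ^ 2)) +
      η x ^ 2 * f x ^ (q - 1) *
        iteratedFDeriv ℝ 2 f x ![EuclideanSpace.single i 1, EuclideanSpace.single i 1] := by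
    intro i x
    have h1 := (hη.differentiable one_ne_zero x).hasFDerivAt
    have h2 := (hf1.differentiable one_ne_zero x).hasFDerivAt
    have h3 := (hdf.differentiable one_ne_zero x).hasFDerivAt.clm_apply
      (hasFDerivAt_const (EuclideanSpace.single i (1 : ℝ)) x)
    have h4 := ((h1.pow 2).mul (h2.rpow_const (p := q - 1) (Or.inl (hfne x)))).mul h3
    have h5 : HasFDerivAt (W i) _ x := h4
    rw [h5.fderiv, iteratedFDeriv_two_apply]
    have e : q - 1 - 1 = q - 2 := by ring
    simp [e]
    ring
  have hint : ∀ g : EuclideanSpace ℝ (Fin n) → ℝ, Continuous g → (∀ x, η x = 0 → g x = 0) →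
      Integrable g := fun g hg h0 =>
    hg.integrable_of_hasCompactSupport (hc.mono fun x hx => by
      contrapose! hx
      simp only [Function.mem_support, not_not] at hx ⊢
      exact h0 x hx)
  have hzero : ∫ x, ∑ i, fderiv ℝ (W i) x (EuclideanSpace.single i 1) = 0 := by
    rw [integral_finsetSum _ fun i _ => ?_]
    · exact Finset.sum_eq_zero fun i _ => integral_fderiv_apply_eq_zero (hW i) (hWc i) _
    · exact (((hW i).continuous_fderiv one_ne_zero).clm_apply
        continuous_const).integrable_of_hasCompactSupport ((hWc i).fderiv_apply (𝕜 := ℝ) _)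
  have hsum : ∀ x, ∑ i, fderiv ℝ (W i) x (EuclideanSpace.single i 1) =
      2 * (η x * f x ^ (q - 1) * ∑ i, fderiv ℝ η x (EuclideanSpace.single i 1) *
        fderiv ℝ f x (EuclideanSpace.single i 1)) +
      (q - 1) * (η x ^ 2 *
        (f x ^ (q - 2) * ∑ i, fderiv ℝ f x (EuclideanSpace.single i 1) ^ 2)) +
      η x ^ 2 * f x ^ (q - 1) * euclideanLaplacian f x := fun x => by
    simp only [hWd, euclideanLaplacian, Finset.sum_add_distrib, Finset.mul_sum]
  rw [← integral_const_mul, ← sub_nonpos, ← integral_sub, ← hzero]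
  · refine integral_mono ?_ ?_ fun x => ?_
    · refine hint _ (by fun_prop) fun x hx => by simp [hx]
    · refine integrable_finsetSum _ fun i _ => ?_
      exact (((hW i).continuous_fderiv one_ne_zero).clm_apply
        continuous_const).integrable_of_hasCompactSupport ((hWc i).fderiv_apply (𝕜 := ℝ) _)
    · dsimp only
      rw [hsum]
      have : 0 ≤ η x ^ 2 * f x ^ (q - 1) * euclideanLaplacian f x :=
        mul_nonneg (mul_nonneg (sq_nonneg _) (Real.rpow_nonneg (hf_pos x).le _)) (hf_sub x)
      linarith
  · exact hint _ (by fun_prop) fun x hx => by simp [hx]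
  · exact hint _ (by fun_prop) fun x hx => by simp [hx]

/-- Weighted Young inequality for the cross term of the Caccioppoli estimate. -/
theorem cross_le_energy_add {ι : Type*} [Fintype ι] {y δ : ℝ} (hy : 0 < y) (hδ : 0 < δ)
    (q η : ℝ) (a b : ι → ℝ) :
    -(2 * (η * y ^ (q - 1) * ∑ i, a i * b i)) ≤
      δ * (η ^ 2 * (y ^ (q - 2) * ∑ i, b i ^ 2)) + δ⁻¹ * (y ^ q * ∑ i, a i ^ 2) := by
  have h1 : y ^ (q - 1) = y ^ (q - 2) * y := by
    rw [← Real.rpow_add_one hy.ne']; ring_nf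
  have h2 : y ^ q = y ^ (q - 2) * y ^ 2 := by
    rw [← Real.rpow_natCast y 2, ← Real.rpow_add hy]; norm_num
  have h : 0 ≤ ∑ i, y ^ (q - 2) * δ * (η * b i + δ⁻¹ * y * a i) ^ 2 :=
    Finset.sum_nonneg fun i _ =>
      mul_nonneg (mul_nonneg (Real.rpow_nonneg hy.le _) hδ.le) (sq_nonneg _)
  have h3 : ∑ i, y ^ (q - 2) * δ * (η * b i + δ⁻¹ * y * a i) ^ 2 =
      δ * (η ^ 2 * (y ^ (q - 2) * ∑ i, b i ^ 2)) + δ⁻¹ * (y ^ q * ∑ i, a i ^ 2) +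
        2 * (η * y ^ (q - 1) * ∑ i, a i * b i) := by
    rw [h1, h2]
    simp only [Finset.mul_sum, ← Finset.sum_add_distrib]
    refine Finset.sum_congr rfl fun i _ => ?_
    field_simp
    ring
  linarith

/-- Caccioppoli estimates for positive subharmonic functions: the energy of `f^(q/2)` (up to a
constant factor) on a ball is controlled by the integral of `f^q` over the doubled ball, with an
arbitrary weight on either the energy itself or its part in the annulus. -/
theorem exists_caccioppoli_bound {n : ℕ} {f : EuclideanSpace ℝ (Fin n) → ℝ}
    (hf_pos : ∀ x, 0 < f x) (hf_C2 : ContDiff ℝ 2 f)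
    (hf_sub : ∀ x, 0 ≤ euclideanLaplacian f x) (q : ℝ) (x₀ : EuclideanSpace ℝ (Fin n))
    {F : EuclideanSpace ℝ (Fin n) → ℝ}
    (hF : ∀ x, F x = f x ^ (q - 2) * ∑ i, fderiv ℝ f x (EuclideanSpace.single i 1) ^ 2)
    (hFc : Continuous F) :
    ∃ C : ℝ, 0 ≤ C ∧ ∀ r : ℝ, 0 < r → ∃ H : ℝ, ∫ x in Metric.ball x₀ (r / 2), F x ≤ H ∧
      ∀ δ : ℝ, 0 < δ →
        (q - 1) * H ≤ δ * H + δ⁻¹ * (C / r ^ 2 * ∫ x in Metric.ball x₀ r, f x ^ q) ∧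
        (q - 1) * H ≤ δ * ((∫ x in Metric.ball x₀ r, F x) - ∫ x in Metric.ball x₀ (r / 2), F x) +
          δ⁻¹ * (C / r ^ 2 * ∫ x in Metric.ball x₀ r, f x ^ q) := by
  obtain ⟨C, hC0, hC⟩ := exists_cutoff_gradient_le n
  refine ⟨C, hC0, fun r hr => ?_⟩
  obtain ⟨η, hη, hc, hη0, hη1, hone, hzero, hgrad⟩ := hC x₀ r hr
  have hF0 : ∀ x, 0 ≤ F x := fun x => by
    rw [hF]
    exact mul_nonneg (Real.rpow_nonneg (hf_pos x).le _)
      (Finset.sum_nonneg fun i _ => sq_nonneg _)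
  have hηc := hη.continuous
  have hdηc := hη.continuous_fderiv one_ne_zero
  have hfc := hf_C2.continuous
  have hdfc := hf_C2.continuous_fderiv two_ne_zero
  have hpc : ∀ p : ℝ, Continuous (fun x => f x ^ p) := fun p =>
    hfc.rpow_const fun x => Or.inl (hf_pos x).ne'
  have hint : ∀ g : EuclideanSpace ℝ (Fin n) → ℝ, Continuous g → (∀ x, η x = 0 → g x = 0) →
      Integrable g := fun g hg h0 =>
    hg.integrable_of_hasCompactSupport (hc.mono fun x hx => by
      contrapose! hx
      simp only [Function.mem_support, not_not] at hx ⊢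
      exact h0 x hx)
  have hball : ∀ (g : EuclideanSpace ℝ (Fin n) → ℝ) (s : ℝ), Continuous g →
      Integrable ((Metric.ball x₀ s).indicator g) := fun g s hg =>
    (integrable_indicator_iff Metric.isOpen_ball.measurableSet).2
      ((hg.continuousOn.integrableOn_compact (isCompact_closedBall x₀ s)).mono_set
        Metric.ball_subset_closedBall)
  have hsplit : ∀ (g : EuclideanSpace ℝ (Fin n) → ℝ) (s : ℝ),
      ∫ x in Metric.ball x₀ s, g x = ∫ x, (Metric.ball x₀ s).indicator g x := fun g s =>
    (integral_indicator Metric.isOpen_ball.measurableSet).symm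
  have hH : Integrable fun x => η x ^ 2 * F x :=
    hint _ (by fun_prop) fun x hx => by simp [hx]
  have henergy := integral_energy_le_integral_cross hf_pos hf_C2 hf_sub q hη hc
  simp only [← hF] at henergy
  have hcross_int : Integrable fun x => -(2 * (η x * f x ^ (q - 1) *
      ∑ i, fderiv ℝ η x (EuclideanSpace.single i 1) *
        fderiv ℝ f x (EuclideanSpace.single i 1))) :=
    hint _ (by fun_prop) fun x hx => by simp [hx]
  have hcrit : ∀ x, (η x = 0 ∨ η x = 1) → fderiv ℝ η x = 0 := by
    rintro x (hx | hx)
    · exact IsLocalMin.fderiv_eq_zero (Eventually.of_forall fun y => hx ▸ hη0 y)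
    · exact IsLocalMax.fderiv_eq_zero (Eventually.of_forall fun y => hx ▸ hη1 y)
  have hpt : ∀ δ : ℝ, 0 < δ → ∀ x, -(2 * (η x * f x ^ (q - 1) *
      ∑ i, fderiv ℝ η x (EuclideanSpace.single i 1) *
        fderiv ℝ f x (EuclideanSpace.single i 1))) ≤ δ * (η x ^ 2 * F x) +
          δ⁻¹ * (C / r ^ 2 * (Metric.ball x₀ r).indicator (fun x => f x ^ q) x) := by
    intro δ hδ x
    have hfq : 0 ≤ f x ^ q := Real.rpow_nonneg (hf_pos x).le _
    by_cases hx : x ∈ Metric.ball x₀ r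
    · rw [Set.indicator_of_mem hx]
      refine (cross_le_energy_add (hf_pos x) hδ q (η x) _ _).trans ?_
      rw [← hF, mul_comm (C / r ^ 2)]
      gcongr
      exact hgrad x
    · rw [Set.indicator_of_notMem hx]
      simp [hzero x hx]
  refine ⟨∫ x, η x ^ 2 * F x, ?_, fun δ hδ => ⟨henergy.trans ?_, henergy.trans ?_⟩⟩
  · rw [hsplit]
    refine integral_mono (hball F _ hFc) hH fun x => ?_
    by_cases hx : x ∈ Metric.ball x₀ (r / 2)
    · simp [hx, hone x hx]
    · simpa [hx] using mul_nonneg (sq_nonneg (η x)) (hF0 x)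
  · rw [hsplit, ← integral_const_mul, ← integral_const_mul, ← integral_const_mul,
      ← integral_add (hH.const_mul _) (((hball _ r (hpc q)).const_mul _).const_mul _)]
    exact integral_mono hcross_int
      ((hH.const_mul _).add (((hball _ r (hpc q)).const_mul _).const_mul _)) (hpt δ hδ)
  · have hA := ((hball F r hFc).sub (hball F (r / 2) hFc)).const_mul δ
    have hB := ((hball _ r (hpc q)).const_mul (C / r ^ 2)).const_mul δ⁻¹
    rw [hsplit, hsplit, hsplit, ← integral_sub (hball F r hFc) (hball F (r / 2) hFc),
      ← integral_const_mul, ← integral_const_mul, ← integral_const_mul]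
    refine (integral_mono hcross_int (hA.add hB) fun x => ?_).trans (integral_add hA hB).le
    have hfq : 0 ≤ f x ^ q := Real.rpow_nonneg (hf_pos x).le _
    have hsub : Metric.ball x₀ (r / 2) ⊆ Metric.ball x₀ r := Metric.ball_subset_ball (by linarith)
    by_cases hx : x ∈ Metric.ball x₀ (r / 2)
    · simp only [hcrit x (Or.inr (hone x hx)), Pi.add_apply, Pi.sub_apply,
        Set.indicator_of_mem hx, Set.indicator_of_mem (hsub hx)]
      simp only [_root_.zero_apply, zero_mul, Finset.sum_const_zero, mul_zero,
        neg_zero, sub_self, zero_add]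
      positivity
    · by_cases hx' : x ∈ Metric.ball x₀ r
      · refine (hpt δ hδ x).trans ?_
        simp only [Pi.add_apply, Pi.sub_apply, Set.indicator_of_mem hx',
          Set.indicator_of_notMem hx, sub_zero]
        gcongr
        exact mul_le_of_le_one_left (hF0 x) (pow_le_one₀ (hη0 x) (hη1 x))
      · simp [hzero x hx', hx, hx']

/-- Finite growth in terms of a lower Lebesgue integral yields quadratic bounds on the Bochner
integrals over arbitrarily large balls. -/
theorem exists_frequently_integral_le_of_liminf_lt_top {n : ℕ}
    {g : EuclideanSpace ℝ (Fin n) → ℝ} (hg : Continuous g) (hg0 : ∀ x, 0 ≤ g x)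
    {x₀ : EuclideanSpace ℝ (Fin n)}
    (h : liminf (fun r : ℝ =>
      (∫⁻ x in Metric.ball x₀ r, ENNReal.ofReal (g x)) / ENNReal.ofReal (r ^ 2)) atTop < ⊤) :
    ∃ K : ℝ, ∃ᶠ r in atTop, ∫ x in Metric.ball x₀ r, g x ≤ K * r ^ 2 := by
  obtain ⟨K, hK1, hK2⟩ := exists_between h
  refine ⟨K.toReal, ?_⟩
  refine ((frequently_lt_of_liminf_lt (by isBoundedDefault) hK1).and_eventually
    (eventually_gt_atTop 0)).mono fun r hr => ?_
  obtain ⟨hlt, hr⟩ := hr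
  have hi : IntegrableOn g (Metric.ball x₀ r) :=
    (hg.continuousOn.integrableOn_compact (isCompact_closedBall x₀ r)).mono_set
      Metric.ball_subset_closedBall
  have hr2 : 0 < r ^ 2 := by positivity
  rw [← ofReal_integral_eq_lintegral_ofReal hi (Eventually.of_forall hg0),
    ← ENNReal.ofReal_div_of_pos hr2, ENNReal.ofReal_lt_iff_lt_toReal
      (div_nonneg (integral_nonneg hg0) hr2.le) hK2.ne, div_lt_iff₀ hr2] at hlt
  exact hlt.le

/-- The `r → ∞` argument: a monotone quantity satisfying Caccioppoli estimates with bounded right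
hand sides at arbitrarily large scales is nonpositive. -/
theorem nonpos_of_frequently_caccioppoli {G : ℝ → ℝ} (hG : Monotone G) {c B : ℝ} (hc : 0 < c)
    (h : ∃ᶠ r in atTop, ∃ H, G (r / 2) ≤ H ∧ ∀ δ : ℝ, 0 < δ →
      c * H ≤ δ * H + δ⁻¹ * B ∧ c * H ≤ δ * (G r - G (r / 2)) + δ⁻¹ * B) (s : ℝ) :
    G s ≤ 0 := by
  have hbdd : ∀ t, G t ≤ (2 / c) * ((2 / c) * B) := fun t => by
    obtain ⟨r, ⟨H, hGH, hH⟩, hr⟩ := (h.and_eventually (eventually_ge_atTop (2 * t))).exists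
    refine (hG (by linarith : t ≤ r / 2)).trans (hGH.trans ?_)
    have h1 := (hH (c / 2) (by positivity)).1
    rw [inv_div] at h1
    have h2 : c / 2 * H ≤ 2 / c * B := by linarith
    calc H = 2 / c * (c / 2 * H) := by field_simp
      _ ≤ _ := by gcongr
  have hlim := tendsto_atTop_ciSup hG ⟨_, Set.forall_mem_range.2 hbdd⟩
  set M := ⨆ t, G t
  have hlim2 : Tendsto (fun r => G (r / 2)) atTop (nhds M) :=
    hlim.comp (tendsto_id.atTop_div_const two_pos)
  have hM : ∀ δ : ℝ, 0 < δ → c * M ≤ δ⁻¹ * B := fun δ hδ => by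
    have ht : Tendsto (fun r => c * G (r / 2) - δ * (G r - G (r / 2))) atTop (nhds (c * M)) := by
      simpa using (hlim2.const_mul c).sub ((hlim.sub hlim2).const_mul δ)
    refine le_of_tendsto_of_frequently ht (h.mono ?_)
    rintro r ⟨H, hGH, hH⟩
    have h1 := (hH δ hδ).2
    have h2 : c * G (r / 2) ≤ c * H := by gcongr
    linarith
  have hM0 : c * M ≤ 0 := by
    have ht : Tendsto (fun δ : ℝ => δ⁻¹ * B) atTop (nhds 0) := by
      simpa using tendsto_inv_atTop_zero.mul_const B
    exact ge_of_tendsto ht ((eventually_gt_atTop 0).mono hM)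
  exact (hG.ge_of_tendsto hlim s).trans (nonpos_of_mul_nonpos_right hM0 hc)

/-- A positive `C²` function on `ℝⁿ` with `Δf ≥ 0` everywhere which has 2-finite growth
with respect to some `q > 1` (i.e. `liminf_{r→∞} (1/r²) ∫_{B(x₀;r)} f^q dx < ∞` for some
point `x₀`) must be constant. -/
theorem euclidean_subharmonic_two_finite_growth_constant
    {n : ℕ} (hn : 1 ≤ n) (f : EuclideanSpace ℝ (Fin n) → ℝ)
    (hf_pos : ∀ x, 0 < f x) (hf_C2 : ContDiff ℝ 2 f)
    (hf_sub : ∀ x, 0 ≤ euclideanLaplacian f x)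
    (q : ℝ) (hq : 1 < q) (x₀ : EuclideanSpace ℝ (Fin n))
    (hgrowth :
      Filter.liminf
        (fun r : ℝ =>
          (∫⁻ x in Metric.ball x₀ r, ENNReal.ofReal (f x ^ q)) / ENNReal.ofReal (r ^ 2))
        Filter.atTop < ⊤) :
    ∃ c : ℝ, ∀ x, f x = c := by
  have hpc : ∀ p : ℝ, Continuous (fun x => f x ^ p) := fun p =>
    hf_C2.continuous.rpow_const fun x => Or.inl (hf_pos x).ne'
  have hdfc := hf_C2.continuous_fderiv two_ne_zero
  obtain ⟨K, hfreq⟩ := exists_frequently_integral_le_of_liminf_lt_top (hpc q)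
    (fun x => Real.rpow_nonneg (hf_pos x).le q) hgrowth
  obtain ⟨F, hF⟩ : ∃ F : EuclideanSpace ℝ (Fin n) → ℝ, ∀ x, F x =
      f x ^ (q - 2) * ∑ i, fderiv ℝ f x (EuclideanSpace.single i 1) ^ 2 := ⟨_, fun _ => rfl⟩
  have hFc : Continuous F := by
    rw [funext hF]
    fun_prop
  have hF0 : ∀ x, 0 ≤ F x := fun x => by
    rw [hF]
    exact mul_nonneg (Real.rpow_nonneg (hf_pos x).le _)
      (Finset.sum_nonneg fun i _ => sq_nonneg _)
  have hFi : ∀ s, IntegrableOn F (Metric.ball x₀ s) := fun s =>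
    (hFc.continuousOn.integrableOn_compact (isCompact_closedBall x₀ s)).mono_set
      Metric.ball_subset_closedBall
  obtain ⟨C, hC, hcac⟩ := exists_caccioppoli_bound hf_pos hf_C2 hf_sub q x₀ hF hFc
  have hmono : Monotone fun s => ∫ x in Metric.ball x₀ s, F x := fun s t hst =>
    setIntegral_mono_set (hFi t) (Eventually.of_forall hF0)
      (Metric.ball_subset_ball hst).eventuallyLE
  have hG := nonpos_of_frequently_caccioppoli hmono (sub_pos.2 hq)
    ((hfreq.and_eventually (eventually_gt_atTop 0)).mono fun r hr => by
      obtain ⟨hA, hr⟩ := hr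
      obtain ⟨H, hGH, hH⟩ := hcac r hr
      have hb : C / r ^ 2 * ∫ x in Metric.ball x₀ r, f x ^ q ≤ C * K := by
        calc _ ≤ C / r ^ 2 * (K * r ^ 2) := by gcongr
          _ = C * K := by field_simp
      refine ⟨H, hGH, fun δ hδ => ?_⟩
      have hb' := mul_le_mul_of_nonneg_left hb (inv_pos.2 hδ).le
      exact ⟨(hH δ hδ).1.trans (by gcongr), (hH δ hδ).2.trans (by gcongr)⟩)
  have hF_zero : ∀ x, F x = 0 := fun x => by
    by_contra hx
    have hxs : x ∈ Metric.ball x₀ (dist x x₀ + 1) := by simp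
    refine (hG (dist x x₀ + 1)).not_gt ?_
    rw [setIntegral_pos_iff_support_of_nonneg_ae (Eventually.of_forall hF0) (hFi _)]
    exact ((hFc.isOpen_support).inter Metric.isOpen_ball).measure_pos _ ⟨x, hx, hxs⟩
  have hfd : ∀ x, fderiv ℝ f x = 0 := fun x => by
    have h := hF_zero x
    rw [hF, mul_eq_zero, or_iff_right (Real.rpow_pos_of_pos (hf_pos x) _).ne',
      Finset.sum_eq_zero_iff_of_nonneg fun i _ => sq_nonneg _] at h
    apply ContinuousLinearMap.coe_injective
    refine (EuclideanSpace.basisFun (Fin n) ℝ).toBasis.ext fun i => ?_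
    simpa using h i (Finset.mem_univ i)
  exact ⟨f 0, fun x => is_const_of_fderiv_eq_zero (hf_C2.differentiable two_ne_zero) hfd x 0⟩
end

section
/- Let n ≥ 1 and let f : ℝⁿ → ℝ be a positive C² function with Δf ≥ 0 everywhere. Suppose there exist a real number q > 1, a point x₀ ∈ ℝⁿ, and a strictly increasing sequence of positive real numbers (r_j)_{j≥0} tending to infinity such that for every index ℓ₀, the series ∑_{j=ℓ₀}^∞ (r_{j+1} − r_j)² / ∫_{B(x₀;r_{j+1}) \ B(x₀;r_j)} f^q dx diverges to infinity (i.e. f has 2-mild growth with respect to q). Then f is constant. -/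
open MeasureTheory Filter

/-- Smooth cutoffs between concentric balls whose gradient is controlled by the inverse of the
width of the annulus. -/
lemma exists_contDiff_cutoff_ball (E : Type*) [NormedAddCommGroup E] [InnerProductSpace ℝ E] :
    ∃ K : ℝ, ∀ (x₀ : E) (r R : ℝ), 0 < r → r < R → ∃ ψ : E → ℝ, ContDiff ℝ 1 ψ ∧
      (∀ x, 0 ≤ ψ x) ∧ (∀ x, ψ x ≤ 1) ∧ (∀ x ∈ Metric.ball x₀ r, ψ x = 1) ∧
      (∀ x ∉ Metric.ball x₀ R, ψ x = 0) ∧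
      (∀ x ∉ Metric.ball x₀ R \ Metric.ball x₀ r, fderiv ℝ ψ x = 0) ∧
      ∀ x, ‖fderiv ℝ ψ x‖ ≤ K / (R - r) := by
  have hcont : Continuous (deriv Real.smoothTransition) :=
    (Real.smoothTransition.contDiff (n := 1)).continuous_deriv (by simp)
  obtain ⟨K, hK⟩ := (isCompact_Icc (a := (0 : ℝ)) (b := 1)).exists_bound_of_continuousOn
    hcont.continuousOn
  have hK0 : 0 ≤ K := (norm_nonneg _).trans (hK 0 (by simp))
  refine ⟨2 * K, fun x₀ r R hr hrR => ?_⟩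
  have hRr : 0 < R ^ 2 - r ^ 2 := by nlinarith
  have hR : 0 < R := hr.trans hrR
  set s : E → ℝ := fun x => (R ^ 2 - ‖x - x₀‖ ^ 2) / (R ^ 2 - r ^ 2) with hs
  have hψ : ContDiff ℝ 1 (fun x => Real.smoothTransition (s x)) :=
    (Real.smoothTransition.contDiff (n := 1)).comp
      ((contDiff_const.sub ((contDiff_id.sub contDiff_const).norm_sq ℝ)).div_const _)
  have hone : ∀ x ∈ Metric.ball x₀ r, Real.smoothTransition (s x) = 1 := fun x hx => by
    rw [Metric.mem_ball, dist_eq_norm] at hx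
    refine Real.smoothTransition.one_of_one_le ((one_le_div hRr).2 ?_)
    nlinarith [norm_nonneg (x - x₀)]
  have hzero : ∀ x ∉ Metric.ball x₀ R, Real.smoothTransition (s x) = 0 := fun x hx => by
    rw [Metric.mem_ball, dist_eq_norm, not_lt] at hx
    refine Real.smoothTransition.zero_of_nonpos (div_nonpos_of_nonpos_of_nonneg ?_ hRr.le)
    nlinarith [norm_nonneg (x - x₀)]
  have hflat : ∀ x ∉ Metric.ball x₀ R \ Metric.ball x₀ r,
      fderiv ℝ (fun x => Real.smoothTransition (s x)) x = 0 := fun x hx => by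
    by_cases hxR : x ∈ Metric.ball x₀ R
    · have hxr : x ∈ Metric.ball x₀ r := by
        by_contra h
        exact hx ⟨hxR, h⟩
      refine IsLocalMax.fderiv_eq_zero (Eventually.of_forall fun y => ?_)
      simpa only [hone x hxr] using Real.smoothTransition.le_one _
    · refine IsLocalMin.fderiv_eq_zero (Eventually.of_forall fun y => ?_)
      simpa only [hzero x hxR] using Real.smoothTransition.nonneg _
  refine ⟨fun x => Real.smoothTransition (s x), hψ, fun x => Real.smoothTransition.nonneg _,
    fun x => Real.smoothTransition.le_one _, hone, hzero, hflat, fun x => ?_⟩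
  by_cases hx : x ∈ Metric.ball x₀ R \ Metric.ball x₀ r
  · obtain ⟨hxR, hxr⟩ := hx
    rw [Metric.mem_ball, dist_eq_norm] at hxR hxr
    have hsx : s x ∈ Set.Icc (0 : ℝ) 1 :=
      ⟨div_nonneg (by nlinarith [norm_nonneg (x - x₀)]) hRr.le,
        (div_le_one hRr).2 (by nlinarith [norm_nonneg (x - x₀)])⟩
    have hs' : HasFDerivAt s ((R ^ 2 - r ^ 2)⁻¹ • -(2 • innerSL ℝ (x - x₀) : E →L[ℝ] ℝ)) x := by
      have h1 : HasFDerivAt (fun y => ‖y - x₀‖ ^ 2) (2 • innerSL ℝ (x - x₀)) x := by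
        simpa using ((hasFDerivAt_id x).sub_const x₀).norm_sq
      simpa [hs, div_eq_inv_mul] using (h1.const_sub (R ^ 2)).const_mul (R ^ 2 - r ^ 2)⁻¹
    have hd : DifferentiableAt ℝ Real.smoothTransition (s x) :=
      (Real.smoothTransition.contDiff (n := 1)).differentiable (by simp) _
    have hcomp := hd.hasDerivAt.comp_hasFDerivAt x hs'
    have hfd : fderiv ℝ (fun x => Real.smoothTransition (s x)) x = _ := hcomp.fderiv
    rw [hfd, norm_smul, norm_smul, norm_neg, ← Nat.cast_smul_eq_nsmul ℝ, norm_smul,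
      innerSL_apply_norm, norm_inv, Real.norm_of_nonneg hRr.le]
    have h2 : (R ^ 2 - r ^ 2)⁻¹ * (2 * ‖x - x₀‖) ≤ 2 / (R - r) := by
      rw [inv_mul_eq_div, div_le_div_iff₀ hRr (by linarith)]
      nlinarith [mul_pos (sub_pos.2 hrR) hr, mul_pos (sub_pos.2 hrR) (sub_pos.2 hxR)]
    calc _ ≤ K * (2 / (R - r)) := by
          refine mul_le_mul (hK _ hsx) (le_trans (le_of_eq ?_) h2) (by positivity) hK0
          simp
      _ = _ := by ring
  · rw [hflat x hx, norm_zero]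
    exact div_nonneg (by linarith) (by linarith)

/-- The derivative of a function on `ℝⁿ` in the `i`-th coordinate direction. -/
noncomputable def coordDeriv {n : ℕ} (i : Fin n) (f : EuclideanSpace ℝ (Fin n) → ℝ)
    (x : EuclideanSpace ℝ (Fin n)) : ℝ :=
  fderiv ℝ f x (EuclideanSpace.single i 1)

section

variable {n : ℕ} {f h ψ : EuclideanSpace ℝ (Fin n) → ℝ}

lemma continuous_coordDeriv (hf : ContDiff ℝ 1 f) (i : Fin n) : Continuous (coordDeriv i f) :=
  (hf.continuous_fderiv (by simp)).clm_apply continuous_const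

lemma contDiff_coordDeriv (hf : ContDiff ℝ 2 f) (i : Fin n) : ContDiff ℝ 1 (coordDeriv i f) :=
  (hf.fderiv_right (m := 1) (by norm_num)).clm_apply contDiff_const

lemma euclideanLaplacian_eq_sum_coordDeriv (hf : ContDiff ℝ 2 f) (x : EuclideanSpace ℝ (Fin n)) :
    euclideanLaplacian f x = ∑ i, coordDeriv i (coordDeriv i f) x := by
  refine Finset.sum_congr rfl fun i _ => ?_
  have hd : DifferentiableAt ℝ (fderiv ℝ f) x :=
    (hf.fderiv_right (m := 1) (by norm_num)).differentiable (by simp) x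
  have := (hd.hasFDerivAt.clm_apply
    (hasFDerivAt_const (EuclideanSpace.single i (1 : ℝ)) x)).fderiv
  have h2 : coordDeriv i (coordDeriv i f) x
    = fderiv ℝ (fun y => fderiv ℝ f y (EuclideanSpace.single i 1)) x
      (EuclideanSpace.single i 1) := rfl
  rw [h2, this, iteratedFDeriv_two_apply]
  simp

/-- A `C²` function with nonnegative Laplacian is weakly subharmonic. -/
lemma integral_sum_coordDeriv_mul_nonpos (hf : ContDiff ℝ 2 f)
    (hf_sub : ∀ x, 0 ≤ euclideanLaplacian f x) (hh : ContDiff ℝ 1 h) (hc : HasCompactSupport h)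
    (h0 : ∀ x, 0 ≤ h x) :
    ∫ x, ∑ i, coordDeriv i f x * coordDeriv i h x ≤ 0 := by
  have hc' : ∀ i, HasCompactSupport (coordDeriv i h) := fun i =>
    hc.fderiv_apply (𝕜 := ℝ) (EuclideanSpace.single i 1)
  have hf1 := contDiff_coordDeriv hf
  have I1 : ∀ i, Integrable fun x => coordDeriv i f x * coordDeriv i h x := fun i =>
    ((hf1 i).continuous.mul (continuous_coordDeriv hh i)).integrable_of_hasCompactSupport
      (hc' i).mul_left
  have I2 : ∀ i, Integrable fun x => coordDeriv i (coordDeriv i f) x * h x := fun i =>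
    ((continuous_coordDeriv (hf1 i) i).mul hh.continuous).integrable_of_hasCompactSupport
      hc.mul_left
  have I3 : ∀ i, Integrable fun x => coordDeriv i f x * h x := fun i =>
    ((hf1 i).continuous.mul hh.continuous).integrable_of_hasCompactSupport hc.mul_left
  have key : ∀ i, ∫ x, coordDeriv i f x * coordDeriv i h x
      = -∫ x, coordDeriv i (coordDeriv i f) x * h x := fun i =>
    integral_mul_fderiv_eq_neg_fderiv_mul_of_integrable (I2 i) (I1 i) (I3 i)
      (fun x _ => (hf1 i).differentiable (by simp) x)
      (fun x _ => hh.differentiable (by simp) x)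
  rw [integral_finsetSum _ fun i _ => I1 i, Finset.sum_congr rfl fun i _ => key i,
    Finset.sum_neg_distrib, ← integral_finsetSum _ fun i _ => I2 i, neg_nonpos]
  refine integral_nonneg fun x => ?_
  simp only [Pi.zero_apply]
  rw [← Finset.sum_mul, ← euclideanLaplacian_eq_sum_coordDeriv hf]
  exact mul_nonneg (hf_sub x) (h0 x)

/-- The weighted gradient density `f ^ (q - 2) |∇f|²`. -/
noncomputable def energyDensity (q : ℝ) (f : EuclideanSpace ℝ (Fin n) → ℝ)
    (x : EuclideanSpace ℝ (Fin n)) : ℝ :=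
  f x ^ (q - 2) * ∑ i, coordDeriv i f x ^ 2

lemma energyDensity_nonneg (hf_pos : ∀ x, 0 < f x) (q : ℝ) (x : EuclideanSpace ℝ (Fin n)) :
    0 ≤ energyDensity q f x :=
  mul_nonneg (Real.rpow_nonneg (hf_pos x).le _) (Finset.sum_nonneg fun _ _ => sq_nonneg _)

lemma continuous_rpow_of_pos (hf_pos : ∀ x, 0 < f x) (hf : Continuous f) (p : ℝ) :
    Continuous fun x => f x ^ p :=
  hf.rpow_const fun x => Or.inl (hf_pos x).ne'

lemma continuous_energyDensity (hf_pos : ∀ x, 0 < f x) (hf : ContDiff ℝ 1 f) (q : ℝ) :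
    Continuous (energyDensity q f) :=
  (continuous_rpow_of_pos hf_pos hf.continuous _).mul
    (continuous_finsetSum _ fun i _ => (continuous_coordDeriv hf i).pow 2)

/-- Testing `Δf ≥ 0` against `ψ² f ^ (q - 1)`. -/
lemma integral_sq_mul_energyDensity_le (hf_pos : ∀ x, 0 < f x) (hf : ContDiff ℝ 2 f)
    (hf_sub : ∀ x, 0 ≤ euclideanLaplacian f x) (q : ℝ) (hψ : ContDiff ℝ 1 ψ)
    (hc : HasCompactSupport ψ) :
    (q - 1) * ∫ x, ψ x ^ 2 * energyDensity q f x ≤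
      -2 * ∫ x, ψ x * f x ^ (q - 1) * ∑ i, coordDeriv i ψ x * coordDeriv i f x := by
  have hf1 : ContDiff ℝ 1 f := hf.of_le (by norm_num)
  have hrp : ContDiff ℝ 1 fun x => f x ^ (q - 1) := hf1.rpow_const_of_ne fun x => (hf_pos x).ne'
  have hh : ContDiff ℝ 1 fun x => ψ x ^ 2 * f x ^ (q - 1) := (hψ.pow 2).mul hrp
  have hc2 : HasCompactSupport fun x => ψ x ^ 2 := by
    simp only [sq]
    exact hc.mul_right
  have hweak := integral_sum_coordDeriv_mul_nonpos hf hf_sub hh hc2.mul_right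
    fun x => mul_nonneg (sq_nonneg _) (Real.rpow_nonneg (hf_pos x).le _)
  have hder : ∀ i x, coordDeriv i (fun x => ψ x ^ 2 * f x ^ (q - 1)) x =
      ψ x ^ 2 * ((q - 1) * f x ^ (q - 2) * coordDeriv i f x) +
        f x ^ (q - 1) * (2 * ψ x * coordDeriv i ψ x) := fun i x => by
    have h1 := (hψ.differentiable (by simp) x).hasFDerivAt.pow 2
    have h2 := (hf1.differentiable (by simp) x).hasFDerivAt.rpow_const (p := q - 1)
      (Or.inl (hf_pos x).ne')
    have h3 : q - 1 - 1 = q - 2 := by ring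
    simp only [coordDeriv]
    have hmul : fderiv ℝ (fun x => ψ x ^ 2 * f x ^ (q - 1)) x = _ := (h1.mul h2).fderiv
    rw [hmul]
    simp [h3]
  have I1 : Integrable fun x => ψ x ^ 2 * energyDensity q f x :=
    ((hψ.continuous.pow 2).mul
      (continuous_energyDensity hf_pos hf1 q)).integrable_of_hasCompactSupport hc2.mul_right
  have I2 : Integrable fun x =>
      ψ x * f x ^ (q - 1) * ∑ i, coordDeriv i ψ x * coordDeriv i f x :=
    ((hψ.continuous.mul hrp.continuous).mul (continuous_finsetSum _ fun i _ =>
      (continuous_coordDeriv hψ i).mul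
        (continuous_coordDeriv hf1 i))).integrable_of_hasCompactSupport hc.mul_right.mul_right
  have hsplit : ∀ x, ∑ i, coordDeriv i f x * coordDeriv i (fun x => ψ x ^ 2 * f x ^ (q - 1)) x =
      (q - 1) * (ψ x ^ 2 * energyDensity q f x) +
        2 * (ψ x * f x ^ (q - 1) * ∑ i, coordDeriv i ψ x * coordDeriv i f x) := fun x => by
    simp only [hder, energyDensity, Finset.mul_sum, ← Finset.sum_add_distrib]
    exact Finset.sum_congr rfl fun i _ => by ring
  simp only [hsplit] at hweak
  rw [integral_add (I1.const_mul _) (I2.const_mul _), integral_const_mul,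
    integral_const_mul] at hweak
  linarith

/-- Caccioppoli inequality on concentric balls, in reciprocal form. -/
lemma exists_ofReal_sq_div_lintegral_le (hf_pos : ∀ x, 0 < f x) (hf : ContDiff ℝ 2 f)
    (hf_sub : ∀ x, 0 ≤ euclideanLaplacian f x) {q : ℝ} (hq : 1 < q) :
    ∃ C : ℝ, 0 ≤ C ∧ ∀ (x₀ : EuclideanSpace ℝ (Fin n)) (r R : ℝ), 0 < r → r < R →
      0 < ∫ x in Metric.ball x₀ r, energyDensity q f x →
      ENNReal.ofReal ((R - r) ^ 2) /
          (∫⁻ x in Metric.ball x₀ R \ Metric.ball x₀ r, ENNReal.ofReal (f x ^ q)) ≤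
        ENNReal.ofReal (C * ((∫ x in Metric.ball x₀ r, energyDensity q f x)⁻¹ -
          (∫ x in Metric.ball x₀ R, energyDensity q f x)⁻¹)) := by
  obtain ⟨K, hK⟩ := exists_contDiff_cutoff_ball (EuclideanSpace ℝ (Fin n))
  refine ⟨4 * (n * K ^ 2) / (q - 1) ^ 2, by positivity, fun x₀ r R hr hrR hQ => ?_⟩
  obtain ⟨ψ, hψ, hψ0, hψ1, hone, hzero, hflat, hbound⟩ := hK x₀ r R hr hrR
  have hf1 : ContDiff ℝ 1 f := hf.of_le (by norm_num)
  set S := Metric.ball x₀ R \ Metric.ball x₀ r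
  have hSm : MeasurableSet S := measurableSet_ball.diff measurableSet_ball
  have hsub : Metric.ball x₀ r ⊆ Metric.ball x₀ R := Metric.ball_subset_ball hrR.le
  have hint_ball : ∀ {g : EuclideanSpace ℝ (Fin n) → ℝ}, Continuous g →
      IntegrableOn g (Metric.ball x₀ R) := fun hg =>
    (hg.continuousOn.integrableOn_compact (isCompact_closedBall x₀ R)).mono_set
      Metric.ball_subset_closedBall
  have hintS : ∀ {g : EuclideanSpace ℝ (Fin n) → ℝ}, Continuous g → IntegrableOn g S :=
    fun hg => (hint_ball hg).mono_set Set.sdiff_subset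
  have hc : HasCompactSupport ψ := HasCompactSupport.intro (isCompact_closedBall x₀ R)
    fun x hx => hzero x fun h => hx (Metric.ball_subset_closedBall h)
  have hcE := continuous_energyDensity hf_pos hf1 q
  have hE0 := energyDensity_nonneg hf_pos q
  have hcψE : Continuous fun x => ψ x ^ 2 * energyDensity q f x :=
    (hψ.continuous.pow 2).mul hcE
  have hcX : Continuous fun x =>
      ψ x * f x ^ (q - 1) * ∑ i, coordDeriv i ψ x * coordDeriv i f x :=
    (hψ.continuous.mul (continuous_rpow_of_pos hf_pos hf.continuous _)).mul
      (continuous_finsetSum _ fun i _ =>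
        (continuous_coordDeriv hψ i).mul (continuous_coordDeriv hf1 i))
  have hcq := continuous_rpow_of_pos hf_pos hf.continuous q
  have htest := integral_sq_mul_energyDensity_le hf_pos hf hf_sub q hψ hc
  have hX : ∫ x, ψ x * f x ^ (q - 1) * ∑ i, coordDeriv i ψ x * coordDeriv i f x =
      ∫ x in S, ψ x * f x ^ (q - 1) * ∑ i, coordDeriv i ψ x * coordDeriv i f x :=
    (setIntegral_eq_integral_of_forall_compl_eq_zero fun x hx => by
      simp [coordDeriv, hflat x hx]).symm
  have hT : ∫ x, ψ x ^ 2 * energyDensity q f x =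
      ∫ x in Metric.ball x₀ R, ψ x ^ 2 * energyDensity q f x :=
    (setIntegral_eq_integral_of_forall_compl_eq_zero fun x hx => by simp [hzero x hx]).symm
  have hTS : ∫ x in S, ψ x ^ 2 * energyDensity q f x =
      (∫ x in Metric.ball x₀ R, ψ x ^ 2 * energyDensity q f x) -
        ∫ x in Metric.ball x₀ r, energyDensity q f x := by
    rw [setIntegral_sdiff measurableSet_ball (hint_ball hcψE) hsub]
    congr 1
    exact setIntegral_congr_fun measurableSet_ball fun x hx => by simp [hone x hx]
  have hTR : ∫ x in Metric.ball x₀ R, ψ x ^ 2 * energyDensity q f x ≤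
      ∫ x in Metric.ball x₀ R, energyDensity q f x :=
    setIntegral_mono (hint_ball hcψE) (hint_ball hcE) fun x =>
      mul_le_of_le_one_left (hE0 x) (pow_le_one₀ (hψ0 x) (hψ1 x))
  have hTQ : 0 ≤ ∫ x in S, ψ x ^ 2 * energyDensity q f x :=
    integral_nonneg fun x => mul_nonneg (sq_nonneg _) (hE0 x)
  have hquad : ∀ x t, 0 ≤ ψ x ^ 2 * energyDensity q f x * (t * t) +
      2 * (ψ x * f x ^ (q - 1) * ∑ i, coordDeriv i ψ x * coordDeriv i f x) * t +
        n * (K / (R - r)) ^ 2 * f x ^ q := fun x t => by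
    have hq1 : f x ^ (q - 1) = f x ^ (q - 2) * f x := by
      rw [← Real.rpow_add_one (hf_pos x).ne']
      ring_nf
    have hq2 : f x ^ q = f x ^ (q - 2) * f x ^ 2 := by
      rw [← Real.rpow_natCast, ← Real.rpow_add (hf_pos x)]
      norm_num
    have hgrad : ∑ i, coordDeriv i ψ x ^ 2 ≤ n * (K / (R - r)) ^ 2 := by
      calc _ ≤ ∑ _i : Fin n, (K / (R - r)) ^ 2 := Finset.sum_le_sum fun i _ => by
            refine sq_le_sq' ?_ ?_ <;>
            · have := ((fderiv ℝ ψ x).le_opNorm (EuclideanSpace.single i 1)).trans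
                (le_of_eq_of_le (by simp) (hbound x))
              rw [Real.norm_eq_abs, abs_le] at this
              simp only [coordDeriv]
              linarith
        _ = _ := by simp
    have hsq : 0 ≤ f x ^ (q - 2) *
        ∑ i, (t * ψ x * coordDeriv i f x + f x * coordDeriv i ψ x) ^ 2 :=
      mul_nonneg (Real.rpow_nonneg (hf_pos x).le _) (Finset.sum_nonneg fun _ _ => sq_nonneg _)
    have hexp : f x ^ (q - 2) *
        ∑ i, (t * ψ x * coordDeriv i f x + f x * coordDeriv i ψ x) ^ 2 =
        ψ x ^ 2 * energyDensity q f x * (t * t) +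
        2 * (ψ x * f x ^ (q - 1) * ∑ i, coordDeriv i ψ x * coordDeriv i f x) * t +
        (∑ i, coordDeriv i ψ x ^ 2) * f x ^ q := by
      rw [hq1, hq2]
      simp only [energyDensity, Finset.mul_sum, Finset.sum_mul, ← Finset.sum_add_distrib]
      exact Finset.sum_congr rfl fun i _ => by ring
    have := mul_le_mul_of_nonneg_right hgrad (Real.rpow_nonneg (hf_pos x).le q)
    linarith
  have hdisc := discrim_le_zero (a := ∫ x in S, ψ x ^ 2 * energyDensity q f x)
    (b := 2 * ∫ x in S, ψ x * f x ^ (q - 1) * ∑ i, coordDeriv i ψ x * coordDeriv i f x)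
    (c := n * (K / (R - r)) ^ 2 * ∫ x in S, f x ^ q) fun t => by
      have := setIntegral_nonneg hSm (μ := volume) fun x _ => hquad x t
      have J1 : IntegrableOn (fun x => ψ x ^ 2 * energyDensity q f x * (t * t)) S :=
        (hintS hcψE).mul_const _
      have J2 : IntegrableOn (fun x =>
          2 * (ψ x * f x ^ (q - 1) * ∑ i, coordDeriv i ψ x * coordDeriv i f x) * t) S :=
        ((hintS hcX).const_mul _).mul_const _
      have J12 : IntegrableOn (fun x => ψ x ^ 2 * energyDensity q f x * (t * t) +
          2 * (ψ x * f x ^ (q - 1) * ∑ i, coordDeriv i ψ x * coordDeriv i f x) * t) S :=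
        J1.add J2
      rwa [integral_add J12 ((hintS hcq).const_mul _), integral_add J1 J2, integral_mul_const,
        integral_mul_const, integral_const_mul, integral_const_mul] at this
  rw [discrim] at hdisc
  rw [hX, hT] at htest
  rw [hTS] at hdisc hTQ
  have hA0 : 0 ≤ ∫ x in S, f x ^ q := integral_nonneg fun x => Real.rpow_nonneg (hf_pos x).le _
  rw [← ofReal_integral_eq_lintegral_ofReal (hintS hcq)
    (Eventually.of_forall fun x => Real.rpow_nonneg (hf_pos x).le _)]
  generalize (∫ x in S, f x ^ q) = A at *
  generalize (∫ x in S, ψ x * f x ^ (q - 1) * ∑ i, coordDeriv i ψ x * coordDeriv i f x) = X at *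
  generalize (∫ x in Metric.ball x₀ R, ψ x ^ 2 * energyDensity q f x) = T at *
  generalize (∫ x in Metric.ball x₀ R, energyDensity q f x) = Q' at *
  generalize (∫ x in Metric.ball x₀ r, energyDensity q f x) = Q at *
  have hT0 : 0 < T := by linarith
  have hqT : 0 < (q - 1) * T := mul_pos (by linarith) hT0
  have hd : 0 < R - r := by linarith
  have hmain : ((q - 1) * T) ^ 2 ≤ 4 * ((T - Q) * (n * (K / (R - r)) ^ 2 * A)) := by
    nlinarith
  have hA : 0 < A := hA0.lt_of_ne fun h => by
    rw [← h] at hmain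
    nlinarith
  rw [← ENNReal.ofReal_div_of_pos hA]
  refine ENNReal.ofReal_le_ofReal ?_
  have hQT : Q⁻¹ - T⁻¹ ≤ Q⁻¹ - Q'⁻¹ := sub_le_sub_left (inv_anti₀ hT0 hTR) _
  have hC : 0 ≤ 4 * (n * K ^ 2) / (q - 1) ^ 2 := by positivity
  refine le_trans ?_ (mul_le_mul_of_nonneg_left hQT hC)
  have hq1 : 0 < q - 1 := by linarith
  have hstep : (R - r) ^ 2 / A ≤ 4 * (n * K ^ 2) / (q - 1) ^ 2 * ((T - Q) / T ^ 2) := by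
    rw [div_mul_div_comm, div_le_div_iff₀ hA (by positivity)]
    have := mul_le_mul_of_nonneg_left hmain (sq_nonneg (R - r))
    have e : (R - r) ^ 2 * (4 * ((T - Q) * (n * (K / (R - r)) ^ 2 * A))) =
        4 * (n * K ^ 2) * (T - Q) * A := by
      field_simp
    rw [e] at this
    linarith
  refine hstep.trans (mul_le_mul_of_nonneg_left ?_ hC)
  rw [inv_sub_inv hQ.ne' hT0.ne']
  exact div_le_div_of_nonneg_left hTQ (by positivity) (by nlinarith)

end

/-- A positive `C²` function on `ℝⁿ` with `Δf ≥ 0` everywhere which has 2-mild growth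
with respect to some `q > 1` (i.e. there are `x₀` and a strictly increasing sequence of
positive radii `r_j → ∞` such that for every `ℓ₀`, the series
`∑_{j=ℓ₀}^∞ (r_{j+1} − r_j)² / ∫_{B(x₀;r_{j+1}) \ B(x₀;r_j)} f^q dx` diverges) must be
constant. -/
theorem euclidean_subharmonic_two_mild_growth_constant
    {n : ℕ} (hn : 1 ≤ n) (f : EuclideanSpace ℝ (Fin n) → ℝ)
    (hf_pos : ∀ x, 0 < f x) (hf_C2 : ContDiff ℝ 2 f)
    (hf_sub : ∀ x, 0 ≤ euclideanLaplacian f x)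
    (q : ℝ) (hq : 1 < q) (x₀ : EuclideanSpace ℝ (Fin n))
    (r : ℕ → ℝ) (hr_pos : ∀ j, 0 < r j) (hr_mono : StrictMono r)
    (hr_tendsto : Filter.Tendsto r Filter.atTop Filter.atTop)
    (hgrowth : ∀ ℓ₀ : ℕ,
      (∑' j : ℕ,
        ENNReal.ofReal ((r (ℓ₀ + j + 1) - r (ℓ₀ + j)) ^ 2) /
          (∫⁻ x in Metric.ball x₀ (r (ℓ₀ + j + 1)) \ Metric.ball x₀ (r (ℓ₀ + j)),
            ENNReal.ofReal (f x ^ q))) = ⊤) :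
    ∃ c : ℝ, ∀ x, f x = c := by
  have hf1 : ContDiff ℝ 1 f := hf_C2.of_le (by norm_num)
  have hcE := continuous_energyDensity hf_pos hf1 q
  have hE0 := energyDensity_nonneg hf_pos q
  obtain ⟨C, hC, hCacc⟩ := exists_ofReal_sq_div_lintegral_le hf_pos hf_C2 hf_sub hq
  set Q : ℕ → ℝ := fun j => ∫ x in Metric.ball x₀ (r j), energyDensity q f x
  have hint_ball : ∀ j, IntegrableOn (energyDensity q f) (Metric.ball x₀ (r j)) := fun j =>
    (hcE.continuousOn.integrableOn_compact (isCompact_closedBall x₀ (r j))).mono_set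
      Metric.ball_subset_closedBall
  have hQmono : Monotone Q := fun i j hij =>
    setIntegral_mono_set (hint_ball j) (Eventually.of_forall hE0)
      (Metric.ball_subset_ball (hr_mono.monotone hij)).eventuallyLE
  have hQ_nonpos : ∀ l, ¬ 0 < Q l := fun l hl => by
    have hpos : ∀ j, 0 < Q (l + j) := fun j => hl.trans_le (hQmono (Nat.le_add_right l j))
    refine (lt_of_le_of_lt (ENNReal.tsum_le_of_sum_range_le (c := ENNReal.ofReal (C * (Q l)⁻¹))
      fun m => ?_) ENNReal.ofReal_lt_top).ne (hgrowth l)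
    have hstep : ∀ j, 0 ≤ C * ((Q (l + j))⁻¹ - (Q (l + j + 1))⁻¹) := fun j =>
      mul_nonneg hC (sub_nonneg.2 (inv_anti₀ (hpos j) (hQmono (Nat.le_succ _))))
    refine (Finset.sum_le_sum fun j _ => hCacc x₀ (r (l + j)) (r (l + j + 1)) (hr_pos _)
      (hr_mono (Nat.lt_succ_self _)) (hpos j)).trans ?_
    rw [← ENNReal.ofReal_sum_of_nonneg fun j _ => hstep j]
    refine ENNReal.ofReal_le_ofReal ?_
    have htel := Finset.sum_range_sub' (fun j => (Q (l + j))⁻¹) m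
    simp only [← add_assoc, add_zero] at htel
    rw [← Finset.mul_sum, htel]
    exact mul_le_mul_of_nonneg_left (sub_le_self _ (inv_nonneg.2 (hpos m).le)) hC
  have hE : ∀ x, energyDensity q f x = 0 := fun x => by
    by_contra hx
    obtain ⟨l, hl⟩ := (hr_tendsto.eventually_gt_atTop (dist x x₀)).exists
    refine hQ_nonpos l ((setIntegral_pos_iff_support_of_nonneg_ae
      (Eventually.of_forall hE0) (hint_ball l)).2 ?_)
    exact (hcE.isOpen_support.inter Metric.isOpen_ball).measure_pos volume ⟨x, hx, hl⟩
  have hderiv : ∀ x, fderiv ℝ f x = 0 := fun x => by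
    have h0 := (mul_eq_zero.1 (hE x)).resolve_left (Real.rpow_pos_of_pos (hf_pos x) _).ne'
    rw [Finset.sum_eq_zero_iff_of_nonneg fun _ _ => sq_nonneg _] at h0
    refine ContinuousLinearMap.coe_injective
      ((EuclideanSpace.basisFun (Fin n) ℝ).toBasis.ext fun i => ?_)
    simpa [coordDeriv] using h0 i (Finset.mem_univ i)
  exact ⟨f x₀, fun x => is_const_of_fderiv_eq_zero (hf1.differentiable (by simp)) hderiv x x₀⟩
end

section
/- Let n ≥ 1 and let f : ℝⁿ → ℝ be a positive C² function with Δf ≥ 0 everywhere. Suppose there exist a real number q > 1 and a point x₀ ∈ ℝⁿ such that for every a > 0 one has ∫_a^∞ ( ∫_{∂B(x₀;r)} f^q dσ )^{−1} dr = ∞, where dσ is the (n−1)-dimensional Hausdorff measure on the sphere ∂B(x₀;r) of radius r centered at x₀ (i.e. f has 2-obtuse growth with respect to q). Then f is constant. -/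
open MeasureTheory Filter
open scoped MeasureTheory

section Sphere

open Set Metric Module
open scoped ENNReal NNReal Pointwise

variable {E : Type*} [NormedAddCommGroup E] [NormedSpace ℝ E]

/-- The cone over a set of diameter at most `d` on the unit sphere is covered by `N + 1` balls of
radius `2 * d` centered on a segment. -/
lemma Ioo_smul_subset_iUnion_closedBall {s : Set E} (hs : ∀ y ∈ s, ‖y‖ = 1) {u : E} (hu : u ∈ s)
    {d : ℝ} (hd : ∀ y ∈ s, dist y u ≤ d) {N : ℕ} (hN : 1 ≤ N * d) :
    Ioo (0 : ℝ) 1 • s ⊆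
      ⋃ k ∈ Finset.range (N + 1), closedBall (((k : ℝ) / N) • u) (2 * d) := by
  rintro _ ⟨t, ⟨ht0, ht1⟩, y, hy, rfl⟩
  have hN0 : (0 : ℝ) < N := by
    rcases Nat.eq_zero_or_pos N with h | h
    · simp [h] at hN
      linarith
    · exact_mod_cast h
  have hd0 : 0 ≤ d := dist_nonneg.trans (hd y hy)
  simp only [mem_iUnion, Finset.mem_range, mem_closedBall]
  refine ⟨⌊t * N⌋₊, ?_, ?_⟩
  · have : ⌊t * N⌋₊ ≤ N := Nat.floor_le_of_le (by nlinarith)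
    omega
  · have h1 : (⌊t * N⌋₊ : ℝ) ≤ t * N := Nat.floor_le (by positivity)
    have h2 : t * N < ⌊t * N⌋₊ + 1 := Nat.lt_floor_add_one _
    have h3 : |t - (⌊t * N⌋₊ : ℝ) / N| ≤ d := by
      have e : t - (⌊t * N⌋₊ : ℝ) / N = (t * N - ⌊t * N⌋₊) / N := by field_simp
      rw [e, abs_of_nonneg (div_nonneg (by linarith) hN0.le), div_le_iff₀ hN0]
      linarith
    calc dist (t • y) (((⌊t * N⌋₊ : ℝ) / N) • u)
        ≤ dist (t • y) (t • u) + dist (t • u) (((⌊t * N⌋₊ : ℝ) / N) • u) := dist_triangle _ _ _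
      _ = t * dist y u + |t - (⌊t * N⌋₊ : ℝ) / N| := by
        rw [dist_smul₀, Real.norm_of_nonneg ht0.le, dist_eq_norm (t • u), ← sub_smul, norm_smul,
          hs u hu, mul_one, Real.norm_eq_abs]
      _ ≤ 1 * d + d := by gcongr; exact hd y hy
      _ = 2 * d := by ring

variable [FiniteDimensional ℝ E] [MeasurableSpace E] [BorelSpace E]

lemma toSphere_le_of_ediam_le (μ : Measure E) [μ.IsAddHaarMeasure] (hE : 1 ≤ finrank ℝ E)
    (s : Set (sphere (0 : E) 1)) {d : ℝ} (hd0 : 0 < d) (hd1 : d ≤ 1)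
    (hs : ediam s ≤ ENNReal.ofReal d) :
    μ.toSphere s ≤ (finrank ℝ E * (3 * 2 ^ finrank ℝ E) * μ (ball 0 1)) *
      ENNReal.ofReal d ^ (finrank ℝ E - 1) := by
  have : Nontrivial E := Module.nontrivial_of_finrank_pos (R := ℝ) (by omega)
  refine (measure_mono subset_closure).trans ?_
  rcases s.eq_empty_or_nonempty with rfl | ⟨u, hu⟩
  · simp
  rw [μ.toSphere_apply' isClosed_closure.measurableSet, mul_assoc (finrank ℝ E : ℝ≥0∞),
    mul_assoc (finrank ℝ E : ℝ≥0∞)]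
  gcongr
  set N := ⌈1 / d⌉₊
  have hN : 1 / d ≤ N := Nat.le_ceil _
  have hN' : (N : ℝ) < 1 / d + 1 := Nat.ceil_lt_add_one (by positivity)
  have hcov := Ioo_smul_subset_iUnion_closedBall (s := Subtype.val '' closure s) (u := (u : E))
    (d := d) (N := N) (by rintro _ ⟨y, -, rfl⟩; simp) ⟨u, subset_closure hu, rfl⟩
    (by
      rintro _ ⟨y, hy, rfl⟩
      have h1 : edist y u ≤ ENNReal.ofReal d :=
        (edist_le_ediam_of_mem hy (subset_closure hu)).trans (by rwa [ediam_closure])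
      rw [← Subtype.dist_eq]
      exact (edist_le_ofReal hd0.le).1 h1)
    (by rwa [div_le_iff₀ hd0] at hN)
  refine (measure_mono hcov).trans ((measure_biUnion_finset_le _ _).trans ?_)
  simp_rw [μ.addHaar_closedBall _ (by positivity : 0 ≤ 2 * d)]
  rw [Finset.sum_const, Finset.card_range, nsmul_eq_mul, ← mul_assoc,
    mul_right_comm (3 * 2 ^ finrank ℝ E)]
  refine mul_le_mul_left ?_ _
  rw [← ENNReal.ofReal_natCast, ← ENNReal.ofReal_mul (by positivity), ← ENNReal.ofReal_pow hd0.le]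
  have e : (3 * 2 ^ finrank ℝ E : ℝ≥0∞) = ENNReal.ofReal (3 * 2 ^ finrank ℝ E) := by
    rw [ENNReal.ofReal_mul (by norm_num), ENNReal.ofReal_pow (by norm_num)]
    norm_num
  rw [e, ← ENNReal.ofReal_mul (by positivity)]
  apply ENNReal.ofReal_le_ofReal
  obtain ⟨m, hm⟩ : ∃ m, finrank ℝ E = m + 1 := ⟨finrank ℝ E - 1, by omega⟩
  rw [hm, Nat.add_sub_cancel, mul_pow, pow_succ d]
  have h3 : ((N + 1 : ℕ) : ℝ) * d ≤ 3 := by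
    push_cast
    have : (1 / d + 1 + 1) * d = 1 + 2 * d := by field_simp; ring
    nlinarith
  calc ((N + 1 : ℕ) : ℝ) * (2 ^ (m + 1) * (d ^ m * d))
      = (((N + 1 : ℕ) : ℝ) * d) * (2 ^ (m + 1) * d ^ m) := by ring
    _ ≤ 3 * (2 ^ (m + 1) * d ^ m) := by gcongr
    _ = 3 * 2 ^ (m + 1) * d ^ m := by ring

/-- The surface measure `μ.toSphere` is dominated by a multiple of the Hausdorff measure. -/
lemma exists_toSphere_le_smul_hausdorffMeasure (μ : Measure E) [μ.IsAddHaarMeasure]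
    (hE : 1 ≤ finrank ℝ E) :
    ∃ C : ℝ≥0∞, C ≠ 0 ∧ C ≠ ∞ ∧
      μ.toSphere ≤ C • (μH[(finrank ℝ E : ℝ) - 1] : Measure (sphere (0 : E) 1)) := by
  set C : ℝ≥0∞ := finrank ℝ E * (3 * 2 ^ finrank ℝ E) * μ (ball 0 1)
  have hC0 : C ≠ 0 := by
    have : μ (ball 0 1) ≠ 0 := (measure_ball_pos μ 0 one_pos).ne'
    have : finrank ℝ E ≠ 0 := by omega
    simp [C, *]
  have hCt : C ≠ ∞ :=
    ENNReal.mul_ne_top (ENNReal.mul_ne_top (by simp) (ENNReal.mul_ne_top (by simp) (by simp)))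
      measure_ball_lt_top.ne
  refine ⟨C, hC0, hCt, ?_⟩
  have key : C⁻¹ • μ.toSphere ≤
      (μH[(finrank ℝ E : ℝ) - 1] : Measure (sphere (0 : E) 1)) := by
    refine Measure.le_hausdorffMeasure _ _ (ENNReal.ofReal (1 / 2)) (by simp) fun s hs ↦ ?_
    have hfin : ediam s ≠ ∞ := ne_top_of_le_ne_top (by simp) hs
    have hle : (ediam s).toReal ≤ 1 / 2 := ENNReal.toReal_le_of_le_ofReal (by norm_num) hs
    have hexp : (finrank ℝ E : ℝ) - 1 = ((finrank ℝ E - 1 : ℕ) : ℝ) := by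
      rw [Nat.cast_sub hE, Nat.cast_one]
    rw [hexp, ENNReal.rpow_natCast, Measure.smul_apply, smul_eq_mul,
      ENNReal.inv_mul_le_iff hC0 hCt]
    have hlim : Tendsto
        (fun t : ℝ ↦ C * ENNReal.ofReal ((ediam s).toReal + t) ^ (finrank ℝ E - 1))
        (nhdsWithin 0 (Ioi 0)) (nhds (C * ediam s ^ (finrank ℝ E - 1))) := by
      have h1 : Tendsto (fun t : ℝ ↦ ENNReal.ofReal ((ediam s).toReal + t))
          (nhdsWithin 0 (Ioi 0)) (nhds (ediam s)) := by
        have : Continuous fun t : ℝ ↦ ENNReal.ofReal ((ediam s).toReal + t) :=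
          ENNReal.continuous_ofReal.comp (by fun_prop)
        have h := (this.tendsto 0).mono_left (nhdsWithin_le_nhds (s := Ioi 0))
        simpa [ENNReal.ofReal_toReal hfin] using h
      exact ENNReal.Tendsto.const_mul (ENNReal.Tendsto.pow h1) (Or.inr hCt)
    refine ge_of_tendsto hlim ?_
    filter_upwards [Ioo_mem_nhdsGT (show (0 : ℝ) < 1 / 2 by norm_num)] with t ht
    have h0 : 0 ≤ (ediam s).toReal := ENNReal.toReal_nonneg
    refine toSphere_le_of_ediam_le μ hE s (by linarith [ht.1]) (by linarith [ht.2]) ?_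
    rw [← ENNReal.ofReal_toReal hfin]
    exact ENNReal.ofReal_le_ofReal (by rw [ENNReal.ofReal_toReal hfin]; linarith [ht.1])
  refine Measure.le_iff.2 fun s hs ↦ ?_
  have := Measure.le_iff.1 key s hs
  rw [Measure.smul_apply, smul_eq_mul, ENNReal.inv_mul_le_iff hC0 hCt] at this
  simpa using this

/-- Integrals over a sphere of radius `r` in polar coordinates are dominated by integrals against
the Hausdorff measure. -/
lemma exists_lintegral_toSphere_le_lintegral_hausdorffMeasure (μ : Measure E) [μ.IsAddHaarMeasure]
    (hE : 1 ≤ finrank ℝ E) :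
    ∃ C : ℝ≥0∞, C ≠ 0 ∧ C ≠ ∞ ∧ ∀ (x₀ : E) (r : ℝ), 0 < r → ∀ g : E → ℝ≥0∞, Measurable g →
      ENNReal.ofReal r ^ (finrank ℝ E - 1) * ∫⁻ ω : sphere (0 : E) 1, g (x₀ + r • ω) ∂μ.toSphere ≤
        C * ∫⁻ x in sphere x₀ r, g x ∂μH[(finrank ℝ E : ℝ) - 1] := by
  obtain ⟨C, hC0, hCt, hC⟩ := exists_toSphere_le_smul_hausdorffMeasure μ hE
  refine ⟨C, hC0, hCt, fun x₀ r hr g hg ↦ ?_⟩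
  set e : sphere (0 : E) 1 → E := fun ω ↦ x₀ + r • (ω : E)
  have he : Continuous e := by fun_prop
  have hexp : (finrank ℝ E : ℝ) - 1 = ((finrank ℝ E - 1 : ℕ) : ℝ) := by
    rw [Nat.cast_sub hE, Nat.cast_one]
  have hanti : AntilipschitzWith (Real.toNNReal r)⁻¹ e := by
    refine AntilipschitzWith.of_le_mul_dist fun x y ↦ ?_
    simp only [e, dist_add_left, dist_smul₀, Real.norm_of_nonneg hr.le, NNReal.coe_inv,
      Real.coe_toNNReal r hr.le, Subtype.dist_eq]
    rw [inv_mul_cancel_left₀ hr.ne']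
  set R : ℝ≥0∞ := ENNReal.ofReal r ^ (finrank ℝ E - 1)
  have hR0 : R ≠ 0 := pow_ne_zero _ (by simpa using hr)
  have hRt : R ≠ ∞ := by simp [R]
  have hle : R • μ.toSphere.map e ≤
      C • (μH[(finrank ℝ E : ℝ) - 1] : Measure E).restrict (sphere x₀ r) := by
    refine Measure.le_iff.2 fun s hs ↦ ?_
    have hpre : e ⁻¹' s = e ⁻¹' (s ∩ sphere x₀ r) := by
      ext ω
      simp [e, norm_smul, abs_of_pos hr]
    simp only [Measure.smul_apply, smul_eq_mul, Measure.map_apply he.measurable hs,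
      Measure.restrict_apply hs]
    rw [hpre]
    have h1 := Measure.le_iff'.1 hC (e ⁻¹' (s ∩ sphere x₀ r))
    have h2 := hanti.hausdorffMeasure_preimage_le (d := (finrank ℝ E : ℝ) - 1)
      (by rw [hexp]; positivity) (s ∩ sphere x₀ r)
    have h3 : (((Real.toNNReal r)⁻¹ : ℝ≥0) : ℝ≥0∞) ^ ((finrank ℝ E : ℝ) - 1) = R⁻¹ := by
      rw [hexp, ENNReal.rpow_natCast, ENNReal.coe_inv (by simpa using hr), ENNReal.inv_pow]
      rfl
    rw [h3] at h2
    calc R * μ.toSphere (e ⁻¹' (s ∩ sphere x₀ r))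
        ≤ R * (C * (R⁻¹ * μH[(finrank ℝ E : ℝ) - 1] (s ∩ sphere x₀ r))) := by
          gcongr
          exact h1.trans (by simpa using mul_le_mul_right h2 C)
      _ = C * μH[(finrank ℝ E : ℝ) - 1] (s ∩ sphere x₀ r) := by
          rw [mul_left_comm, ← mul_assoc R, ENNReal.mul_inv_cancel hR0 hRt, one_mul]
  have h := lintegral_mono' hle (le_refl g)
  rwa [lintegral_smul_measure, lintegral_smul_measure, lintegral_map hg he.measurable] at h

/-- Integration in polar coordinates. -/
lemma integral_eq_integral_Ioi_toSphere (μ : Measure E) [μ.IsAddHaarMeasure]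
    (hE : 1 ≤ finrank ℝ E) {g : E → ℝ} (hg : Integrable g μ) :
    ∫ x, g x ∂μ = ∫ r in Ioi (0 : ℝ),
      r ^ (finrank ℝ E - 1) * ∫ ω : sphere (0 : E) 1, g (r • ω) ∂μ.toSphere := by
  have : Nontrivial E := Module.nontrivial_of_finrank_pos (R := ℝ) (by omega)
  have hmp := μ.measurePreserving_homeomorphUnitSphereProd
  set G : sphere (0 : E) 1 × Ioi (0 : ℝ) → ℝ := fun p ↦ g (p.2.1 • (p.1 : E))
  have hG : ∀ x : ({0}ᶜ : Set E), G (homeomorphUnitSphereProd E x) = g x := by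
    intro x
    have hx : ‖(x : E)‖ ≠ 0 := norm_ne_zero_iff.2 x.2
    simp [G, smul_smul, hx]
  have hGi : Integrable G (μ.toSphere.prod (Measure.volumeIoiPow (finrank ℝ E - 1))) := by
    rw [← hmp.integrable_comp_emb (Homeomorph.measurableEmbedding _)]
    have : G ∘ homeomorphUnitSphereProd E = g ∘ Subtype.val := funext hG
    rw [this, ← integrableOn_iff_comap_subtypeVal (measurableSet_singleton _).compl]
    exact hg.integrableOn
  calc ∫ x, g x ∂μ = ∫ x : ({0}ᶜ : Set E), g x ∂(μ.comap Subtype.val) := by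
        rw [integral_subtype_comap (measurableSet_singleton _).compl fun x ↦ g x,
          restrict_compl_singleton]
    _ = ∫ p, G p ∂μ.toSphere.prod (Measure.volumeIoiPow (finrank ℝ E - 1)) := by
        rw [← hmp.integral_comp (Homeomorph.measurableEmbedding _)]
        simp_rw [hG]
    _ = ∫ r : Ioi (0 : ℝ), ∫ ω : sphere (0 : E) 1, g (r.1 • (ω : E)) ∂μ.toSphere
          ∂Measure.volumeIoiPow (finrank ℝ E - 1) := integral_prod_symm _ hGi
    _ = _ := by
        simp only [Measure.volumeIoiPow, ENNReal.ofReal]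
        rw [integral_withDensity_eq_integral_smul
            ((measurable_subtype_coe.pow_const _).real_toNNReal),
          integral_subtype_comap measurableSet_Ioi fun r ↦
            Real.toNNReal (r ^ (finrank ℝ E - 1)) •
              ∫ ω : sphere (0 : E) 1, g (r • (ω : E)) ∂μ.toSphere]
        refine setIntegral_congr_fun measurableSet_Ioi fun r hr ↦ ?_
        simp only [NNReal.smul_def, smul_eq_mul]
        rw [Real.coe_toNNReal _ (pow_nonneg (le_of_lt hr) _)]

end Sphere

section Divergence

open Set Metric Module

/-- A continuous function on the half-line whose weak derivative is a continuous function, tested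
against functions of `r ^ 2` that need not vanish near the origin, is its primitive vanishing
at `0`. -/
lemma eq_intervalIntegral_of_forall_test {A B : ℝ → ℝ} (hA : Continuous A) (hB : Continuous B)
    (hAB : ∀ (h k : ℝ → ℝ) (R : ℝ), 0 < R → Continuous k → (∀ s, HasDerivAt h (k s) s) →
      (∀ s, R ^ 2 ≤ s → h s = 0) → (∀ s, R ^ 2 ≤ s → k s = 0) →
      ∫ r in (0 : ℝ)..R, h (r ^ 2) * A r = -∫ r in (0 : ℝ)..R, 2 * r * k (r ^ 2) * B r)
    {r : ℝ} (hr : 0 < r) : B r = ∫ s in (0 : ℝ)..r, A s := by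
  set F : ℝ → ℝ := fun r ↦ ∫ s in (0 : ℝ)..r, A s
  have hF : ∀ r, HasDerivAt F (A r) r := fun r ↦
    (hA.integral_hasStrictDerivAt 0 r).hasDerivAt
  have hFc : Continuous F := continuous_iff_continuousAt.2 fun r ↦ (hF r).continuousAt
  have hae : ∀ᵐ r : ℝ, r ∈ Ioi (0 : ℝ) → F r - B r = 0 := by
    refine isOpen_Ioi.ae_eq_zero_of_integral_contDiff_smul_eq_zero
      ((hFc.sub hB).locallyIntegrable.locallyIntegrableOn _) fun g hg hgc hgs ↦ ?_
    obtain ⟨R, hR⟩ := hgc.isCompact.isBounded.subset_closedBall (0 : ℝ)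
    have hgR : ∀ r, max R 0 + 1 ≤ r → g r = 0 := by
      intro r hr
      refine image_eq_zero_of_notMem_tsupport fun hmem ↦ ?_
      have := hR hmem
      rw [mem_closedBall, dist_zero_right, Real.norm_eq_abs] at this
      linarith [le_abs_self r, le_max_left R 0]
    have hg0 : ∀ r, r ≤ 0 → g r = 0 := fun r hr ↦
      image_eq_zero_of_notMem_tsupport fun hmem ↦ not_lt.2 hr (hgs hmem)
    set T := max R 0 + 1
    have hT : 0 < T := by positivity
    set l : ℝ → ℝ := fun r ↦ g r / (2 * r)
    have hl : Continuous l := by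
      refine continuous_of_tsupport fun r hr ↦ ?_
      have hr' : r ∈ tsupport g := by
        refine closure_mono (fun x hx ↦ ?_) hr
        simp only [Function.mem_support, l] at hx ⊢
        exact fun h ↦ hx (by simp [h])
      have : (2 * r) ≠ 0 := mul_ne_zero two_ne_zero (ne_of_gt (hgs hr'))
      exact hg.continuous.continuousAt.div (by fun_prop) this
    set k : ℝ → ℝ := fun s ↦ l (√s)
    have hk : Continuous k := hl.comp Real.continuous_sqrt
    have hkT : ∀ s, T ^ 2 ≤ s → k s = 0 := fun s hs ↦ by
      simp [k, l, hgR _ (Real.le_sqrt_of_sq_le hs)]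
    have hkr : ∀ r, 0 ≤ r → 2 * r * k (r ^ 2) = g r := by
      intro r hr
      simp only [k, l, Real.sqrt_sq hr]
      rcases hr.eq_or_lt with rfl | h
      · simp [hg0 0 le_rfl]
      · field_simp
    set h : ℝ → ℝ := fun s ↦ ∫ t in (T ^ 2)..s, k t
    have hh : ∀ s, HasDerivAt h (k s) s := fun s ↦
      (hk.integral_hasStrictDerivAt _ s).hasDerivAt
    have hhT : ∀ s, T ^ 2 ≤ s → h s = 0 := by
      intro s hs
      refine (intervalIntegral.integral_congr (g := fun _ ↦ 0) fun t ht ↦ ?_).trans (by simp)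
      rw [uIcc_of_le hs] at ht
      exact hkT t ht.1
    have h1 := hAB h k T hT hk hh hhT hkT
    have h2 : ∫ r in (0 : ℝ)..T, h (r ^ 2) * A r =
        -∫ r in (0 : ℝ)..T, 2 * r * k (r ^ 2) * F r := by
      have hH : ∀ r, HasDerivAt (fun r ↦ h (r ^ 2)) (2 * r * k (r ^ 2)) r := by
        intro r
        have := (hh (r ^ 2)).comp r (hasDerivAt_pow 2 r)
        refine this.congr_deriv ?_
        push_cast
        ring
      rw [intervalIntegral.integral_mul_deriv_eq_deriv_mul (fun r _ ↦ hH r) (fun r _ ↦ hF r)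
        (Continuous.intervalIntegrable (by fun_prop) _ _) (hA.intervalIntegrable _ _)]
      simp [hhT _ le_rfl, F]
    have h3 : ∫ r in (0 : ℝ)..T, g r * (F r - B r) = 0 := by
      have e : ∀ G : ℝ → ℝ, ∫ r in (0 : ℝ)..T, 2 * r * k (r ^ 2) * G r =
          ∫ r in (0 : ℝ)..T, g r * G r := fun G ↦ by
        refine intervalIntegral.integral_congr fun r hr ↦ ?_
        rw [uIcc_of_le hT.le] at hr
        simp only [hkr r hr.1]
      rw [e] at h1 h2
      simp_rw [mul_sub]
      have hgc' := hg.continuous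
      rw [intervalIntegral.integral_sub (Continuous.intervalIntegrable (by fun_prop) _ _)
        (Continuous.intervalIntegrable (by fun_prop) _ _)]
      linarith
    rw [intervalIntegral.integral_of_le hT.le] at h3
    rw [← h3]
    refine (setIntegral_eq_integral_of_forall_compl_eq_zero fun r hr ↦ ?_).symm
    rw [mem_Ioc, not_and_or, not_lt, not_le] at hr
    rcases hr with hr | hr
    · simp [hg0 r hr]
    · simp [hgR r hr.le]
  have hEq : EqOn (fun r ↦ F r - B r) (fun _ ↦ 0) (Ioi 0) := by
    refine Measure.eqOn_open_of_ae_eq (μ := volume) ?_ isOpen_Ioi (by fun_prop) (by fun_prop)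
    rwa [EventuallyEq, ae_restrict_iff' measurableSet_Ioi]
  linarith [hEq hr]

variable {n : ℕ}

/-- Integration by parts of a vector field against a radial cutoff function. -/
lemma integral_mul_divergence_eq_neg {X : Fin n → EuclideanSpace ℝ (Fin n) → ℝ}
    (hX : ∀ i, ContDiff ℝ 1 (X i)) {h k : ℝ → ℝ} {R : ℝ} (hk : Continuous k)
    (hh : ∀ s, HasDerivAt h (k s) s) (hhR : ∀ s, R ^ 2 ≤ s → h s = 0)
    (hkR : ∀ s, R ^ 2 ≤ s → k s = 0) :
    ∫ x, h (‖x‖ ^ 2) * ∑ i, fderiv ℝ (X i) x (EuclideanSpace.single i 1) =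
      -∫ x, 2 * k (‖x‖ ^ 2) * ∑ i, x i * X i x := by
  have hhc : Continuous h := continuous_iff_continuousAt.2 fun s ↦ (hh s).continuousAt
  have hψ : ∀ x : EuclideanSpace ℝ (Fin n), HasFDerivAt (fun x ↦ h (‖x‖ ^ 2))
      (k (‖x‖ ^ 2) • (2 • innerSL ℝ x)) x := fun x ↦
    (hh (‖x‖ ^ 2)).comp_hasFDerivAt x (HasStrictFDerivAt.hasFDerivAt (hasStrictFDerivAt_norm_sq x))
  have hsupp : ∀ g : EuclideanSpace ℝ (Fin n) → ℝ, Continuous g →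
      (∀ x, R ^ 2 ≤ ‖x‖ ^ 2 → g x = 0) → Integrable g := by
    intro g hg hg0
    refine hg.integrable_of_hasCompactSupport
      (HasCompactSupport.intro (isCompact_closedBall 0 |R|) fun x hx ↦ hg0 x ?_)
    rw [mem_closedBall, dist_zero_right, not_le] at hx
    exact sq_le_sq' (by linarith [neg_abs_le R]) (by linarith [le_abs_self R])
  have hXc : ∀ i, Continuous (X i) := fun i ↦ (hX i).continuous
  have hXd : ∀ i, Continuous fun x ↦ fderiv ℝ (X i) x (EuclideanSpace.single i 1) := fun i ↦
    ((hX i).continuous_fderiv one_ne_zero).clm_apply continuous_const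
  have hfd : ∀ i x, fderiv ℝ (fun x : EuclideanSpace ℝ (Fin n) ↦ h (‖x‖ ^ 2)) x
      (EuclideanSpace.single i 1) = 2 * k (‖x‖ ^ 2) * x i := by
    intro i x
    rw [(hψ x).fderiv]
    simp [EuclideanSpace.inner_single_right]
    ring
  have hi1 : ∀ i, Integrable fun x ↦
      h (‖x‖ ^ 2) * fderiv ℝ (X i) x (EuclideanSpace.single i 1) := fun i ↦
    hsupp _ ((by fun_prop : Continuous fun x : EuclideanSpace ℝ (Fin n) ↦ h (‖x‖ ^ 2)).mul (hXd i))
      fun x hx ↦ by simp [hhR _ hx]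
  have hi2 : ∀ i, Integrable fun x : EuclideanSpace ℝ (Fin n) ↦
      2 * k (‖x‖ ^ 2) * x i * X i x := fun i ↦
    hsupp _ (by fun_prop) fun x hx ↦ by simp [hkR _ hx]
  have hparts : ∀ i, ∫ x, h (‖x‖ ^ 2) * fderiv ℝ (X i) x (EuclideanSpace.single i 1) =
      -∫ x, 2 * k (‖x‖ ^ 2) * x i * X i x := by
    intro i
    have := integral_mul_fderiv_eq_neg_fderiv_mul_of_integrable (μ := volume)
      (f := fun x : EuclideanSpace ℝ (Fin n) ↦ h (‖x‖ ^ 2)) (g := X i)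
      (v := EuclideanSpace.single i 1) (by simpa only [hfd] using hi2 i) (hi1 i)
      (hsupp _ (by fun_prop) fun x hx ↦ by simp [hhR _ hx])
      (fun x _ ↦ (hψ x).differentiableAt)
      (fun x _ ↦ (hX i).differentiable one_ne_zero x)
    simpa only [hfd] using this
  simp_rw [Finset.mul_sum, ← mul_assoc]
  rw [integral_finsetSum _ fun i _ ↦ hi1 i, integral_finsetSum _ fun i _ ↦ hi2 i,
    ← Finset.sum_neg_distrib]
  exact Finset.sum_congr rfl fun i _ ↦ hparts i

/-- Continuity in the radius of integrals over spheres. -/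
lemma continuous_pow_mul_integral_toSphere {E : Type*} [NormedAddCommGroup E] [NormedSpace ℝ E]
    [FiniteDimensional ℝ E] [MeasurableSpace E] [BorelSpace E] (μ : Measure E) [μ.IsAddHaarMeasure]
    (m : ℕ) {g : ℝ → sphere (0 : E) 1 → ℝ} (hg : Continuous g.uncurry) :
    Continuous fun r : ℝ ↦ r ^ m * ∫ ω, g r ω ∂μ.toSphere := by
  have h := continuous_parametric_integral_of_continuous (μ := μ.toSphere) hg isCompact_univ
  simp only [Measure.restrict_univ] at h
  exact (continuous_pow m).mul h

/-- The divergence theorem on balls: the flux of a `C¹` vector field through the sphere of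
radius `r` is the integral of its divergence over the ball, in polar coordinates. -/
lemma flux_toSphere_eq_integral_divergence (hn : 1 ≤ n)
    {X : Fin n → EuclideanSpace ℝ (Fin n) → ℝ} (hX : ∀ i, ContDiff ℝ 1 (X i)) {r : ℝ}
    (hr : 0 < r) :
    r ^ (n - 1) * ∫ ω : sphere (0 : EuclideanSpace ℝ (Fin n)) 1,
        ∑ i, ω.1 i * X i (r • ω.1) ∂(volume : Measure (EuclideanSpace ℝ (Fin n))).toSphere =
      ∫ s in (0 : ℝ)..r, s ^ (n - 1) * ∫ ω : sphere (0 : EuclideanSpace ℝ (Fin n)) 1,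
        ∑ i, fderiv ℝ (X i) (s • ω.1) (EuclideanSpace.single i 1)
          ∂(volume : Measure (EuclideanSpace ℝ (Fin n))).toSphere := by
  have hXc : ∀ i, Continuous (X i) := fun i ↦ (hX i).continuous
  have hXd : ∀ i, Continuous fun x ↦ fderiv ℝ (X i) x (EuclideanSpace.single i 1) := fun i ↦
    ((hX i).continuous_fderiv one_ne_zero).clm_apply continuous_const
  have hdim : finrank ℝ (EuclideanSpace ℝ (Fin n)) = n := finrank_euclideanSpace_fin
  refine eq_intervalIntegral_of_forall_test
    (B := fun r ↦ r ^ (n - 1) * ∫ ω : sphere (0 : EuclideanSpace ℝ (Fin n)) 1,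
        ∑ i, ω.1 i * X i (r • ω.1) ∂(volume : Measure (EuclideanSpace ℝ (Fin n))).toSphere)
    (continuous_pow_mul_integral_toSphere volume _ ?_)
    (continuous_pow_mul_integral_toSphere volume _ ?_)
    (fun h k R hR hk hh hhR hkR ↦ ?_) hr
  · exact continuous_finsetSum _ fun i _ ↦ (hXd i).comp
      (by fun_prop : Continuous fun p : ℝ × sphere (0 : EuclideanSpace ℝ (Fin n)) 1 ↦ p.1 • p.2.1)
  · refine continuous_finsetSum _ fun i _ ↦ ?_
    dsimp only
    fun_prop
  have hhc : Continuous h := continuous_iff_continuousAt.2 fun s ↦ (hh s).continuousAt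
  have hsupp : ∀ g : EuclideanSpace ℝ (Fin n) → ℝ, Continuous g →
      (∀ x, R ^ 2 ≤ ‖x‖ ^ 2 → g x = 0) → ∫ x, g x = ∫ r in (0 : ℝ)..R, r ^ (n - 1) *
        ∫ ω : sphere (0 : EuclideanSpace ℝ (Fin n)) 1, g (r • ω.1)
          ∂(volume : Measure (EuclideanSpace ℝ (Fin n))).toSphere := by
    intro g hg hg0
    have hgi : Integrable g := by
      refine hg.integrable_of_hasCompactSupport
        (HasCompactSupport.intro (isCompact_closedBall 0 R) fun x hx ↦ hg0 x ?_)
      rw [mem_closedBall, dist_zero_right, not_le] at hx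
      exact pow_le_pow_left₀ hR.le hx.le 2
    rw [integral_eq_integral_Ioi_toSphere volume (by rwa [hdim]) hgi, hdim,
      intervalIntegral.integral_of_le hR.le]
    refine setIntegral_eq_of_subset_of_forall_sdiff_eq_zero measurableSet_Ioi
      Ioc_subset_Ioi_self fun r hr ↦ ?_
    have hr0 : 0 < r := hr.1
    have hrR : R ≤ r := by
      by_contra! hlt
      exact hr.2 ⟨hr0, hlt.le⟩
    have : ∀ ω : sphere (0 : EuclideanSpace ℝ (Fin n)) 1, g (r • ω.1) = 0 := fun ω ↦
      hg0 _ (by simpa [norm_smul] using pow_le_pow_left₀ hR.le hrR 2)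
    simp [this]
  have hmain := integral_mul_divergence_eq_neg hX hk hh hhR hkR
  have hnorm : ∀ (r : ℝ) (ω : sphere (0 : EuclideanSpace ℝ (Fin n)) 1), ‖r • ω.1‖ ^ 2 = r ^ 2 :=
    fun r ω ↦ by simp [norm_smul]
  rw [hsupp (fun x ↦ h (‖x‖ ^ 2) * ∑ i, fderiv ℝ (X i) x (EuclideanSpace.single i 1))
      (.mul (by fun_prop) (continuous_finsetSum _ fun i _ ↦ hXd i)) fun x hx ↦ by simp [hhR _ hx],
    hsupp (fun x ↦ 2 * k (‖x‖ ^ 2) * ∑ i, x i * X i x) (by fun_prop) fun x hx ↦ by simp [hkR _ hx]] at hmain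
  simp only [hnorm, integral_const_mul] at hmain
  convert hmain using 2
  · ext r
    ring
  · refine intervalIntegral.integral_congr fun r _ ↦ ?_
    simp only [PiLp.smul_apply, smul_eq_mul, mul_assoc, ← Finset.mul_sum, integral_const_mul]
    ring

end Divergence

section Growth

open Set Metric Module

/-- A form of the Cauchy–Schwarz inequality: a pointwise bound `b ^ 2 ≤ p * d` between integrable
functions with `p` and `d` nonnegative passes to the integrals. -/
lemma sq_integral_le_integral_mul_integral {α : Type*} [MeasurableSpace α] {μ : Measure α}
    {b p d : α → ℝ} (hb : Integrable b μ) (hp : Integrable p μ) (hd : Integrable d μ)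
    (hp0 : ∀ x, 0 ≤ p x) (hd0 : ∀ x, 0 ≤ d x) (h : ∀ x, b x ^ 2 ≤ p x * d x) :
    (∫ x, b x ∂μ) ^ 2 ≤ (∫ x, p x ∂μ) * ∫ x, d x ∂μ := by
  have key : ∀ t : ℝ, 0 ≤ (∫ x, p x ∂μ) * (t * t) + (2 * ∫ x, b x ∂μ) * t + ∫ x, d x ∂μ := by
    intro t
    have e : ∫ x, (p x * (t * t) + 2 * b x * t + d x) ∂μ =
        (∫ x, p x ∂μ) * (t * t) + (2 * ∫ x, b x ∂μ) * t + ∫ x, d x ∂μ := by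
      have hp' := hp.mul_const (t * t)
      have hb' := (hb.const_mul 2).mul_const t
      have hpb : Integrable (fun x ↦ p x * (t * t) + 2 * b x * t) μ := hp'.add hb'
      rw [integral_add hpb hd, integral_add hp' hb', integral_mul_const,
        integral_mul_const, integral_const_mul]
    rw [← e]
    refine integral_nonneg fun x ↦ ?_
    have hx := h x
    simp only [Pi.zero_apply]
    rcases (hp0 x).eq_or_lt with hz | hpos
    · have hbz : b x = 0 := by
        rw [← hz, zero_mul] at hx
        exact pow_eq_zero_iff two_ne_zero |>.1 (le_antisymm hx (sq_nonneg _))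
      simp [← hz, hbz, hd0 x]
    · have : 0 ≤ p x * (p x * (t * t) + 2 * b x * t + d x) := by
        nlinarith [sq_nonneg (p x * t + b x)]
      exact nonneg_of_mul_nonneg_right this hpos
  have := discrim_le_zero key
  rw [discrim] at this
  nlinarith

/-- The comparison argument for the differential inequality `c * F ^ 2 ≤ j * F'`. -/
lemma lintegral_Ioi_inv_lt_top_of_sq_le {F A j : ℝ → ℝ} (hF : ∀ r, HasDerivAt F (A r) r)
    (hA : Continuous A) (hA0 : ∀ r, 0 < r → 0 ≤ A r) (hj : ∀ r, 0 < r → 0 ≤ j r) {c : ℝ}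
    (hc : 0 < c) (h : ∀ r, 0 < r → c * F r ^ 2 ≤ j r * A r) {a : ℝ} (ha : 0 < a) (hFa : 0 < F a) :
    ∫⁻ r in Ioi a, (ENNReal.ofReal (j r))⁻¹ < ⊤ := by
  have hFc : Continuous F := continuous_iff_continuousAt.2 fun r ↦ (hF r).continuousAt
  have hmono : MonotoneOn F (Ici a) := by
    refine monotoneOn_of_deriv_nonneg (convex_Ici a) hFc.continuousOn
      (fun r _ ↦ (hF r).differentiableAt.differentiableWithinAt) fun r hr ↦ ?_
    rw [interior_Ici, mem_Ioi] at hr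
    rw [(hF r).deriv]
    exact hA0 r (ha.trans hr)
  have hFpos : ∀ r, a ≤ r → 0 < F r := fun r hr ↦ hFa.trans_le (hmono self_mem_Ici hr hr)
  have hcont : ∀ b, ContinuousOn (fun r ↦ A r / (c * F r ^ 2)) (Icc a b) := fun b ↦
    hA.continuousOn.div (by fun_prop) fun r hr ↦ (mul_pos hc (pow_pos (hFpos r hr.1) 2)).ne'
  have hint : IntegrableOn (fun r ↦ A r / (c * F r ^ 2)) (Ioi a) := by
    refine integrableOn_Ioi_of_intervalIntegral_norm_bounded (1 / (c * F a)) a (b := id)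
      (l := atTop) (fun b ↦ (hcont b).integrableOn_Icc.mono_set Ioc_subset_Icc_self) tendsto_id ?_
    filter_upwards [eventually_ge_atTop a] with b hb
    have e : ∫ r in a..b, ‖A r / (c * F r ^ 2)‖ = ∫ r in a..b, A r / (c * F r ^ 2) := by
      refine intervalIntegral.integral_congr fun r hr ↦ ?_
      rw [uIcc_of_le hb] at hr
      exact Real.norm_of_nonneg (div_nonneg (hA0 r (ha.trans_le hr.1)) (by positivity))
    have hderiv : ∀ r ∈ uIcc a b, HasDerivAt (fun r ↦ -(c * F r)⁻¹) (A r / (c * F r ^ 2)) r := by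
      intro r hr
      rw [uIcc_of_le hb] at hr
      have hr' := hFpos r hr.1
      refine (((hF r).const_mul c).fun_inv (mul_pos hc hr').ne').fun_neg.congr_deriv ?_
      field_simp
    rw [id, e, intervalIntegral.integral_eq_sub_of_hasDerivAt hderiv
      (ContinuousOn.intervalIntegrable (by rw [uIcc_of_le hb]; exact hcont b))]
    have := hFpos b hb
    have : 0 < (c * F b)⁻¹ := by positivity
    rw [one_div]
    linarith
  refine lt_of_le_of_lt ?_ hint.lintegral_lt_top
  refine setLIntegral_mono' measurableSet_Ioi fun r hr ↦ ?_
  have hr0 : 0 < r := ha.trans hr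
  have hFr : 0 < F r := hFpos r (le_of_lt hr)
  have hjA : 0 < j r * A r := lt_of_lt_of_le (by positivity) (h r hr0)
  have hjr : 0 < j r := (hj r hr0).lt_of_ne fun h0 ↦ by simp [← h0] at hjA
  rw [← ENNReal.ofReal_inv_of_pos hjr]
  refine ENNReal.ofReal_le_ofReal ?_
  rw [le_div_iff₀ (by positivity), inv_mul_le_iff₀ hjr]
  exact h r hr0

variable {n : ℕ} {u : EuclideanSpace ℝ (Fin n) → ℝ}

/-- The divergence of `u ^ (q - 1) ∇u`. -/
lemma fderiv_rpow_mul_fderiv_single (hu : ContDiff ℝ 2 u) (hpos : ∀ x, 0 < u x) (q : ℝ)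
    (i : Fin n) (x : EuclideanSpace ℝ (Fin n)) :
    fderiv ℝ (fun x ↦ u x ^ (q - 1) * fderiv ℝ u x (EuclideanSpace.single i 1)) x
        (EuclideanSpace.single i 1) =
      (q - 1) * u x ^ (q - 2) * fderiv ℝ u x (EuclideanSpace.single i 1) ^ 2 +
        u x ^ (q - 1) *
          iteratedFDeriv ℝ 2 u x ![EuclideanSpace.single i 1, EuclideanSpace.single i 1] := by
  have h1 : HasFDerivAt u (fderiv ℝ u x) x := (hu.differentiable two_ne_zero x).hasFDerivAt
  have h2 : HasFDerivAt (fderiv ℝ u) (fderiv ℝ (fderiv ℝ u) x) x :=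
    ((hu.fderiv_right (m := 1) le_rfl).differentiable one_ne_zero x).hasFDerivAt
  have h3 := h1.rpow_const (p := q - 1) (Or.inl (hpos x).ne')
  have h4 := h2.clm_apply (hasFDerivAt_const (EuclideanSpace.single i (1 : ℝ)) x)
  rw [(h3.fun_mul h4).fderiv, iteratedFDeriv_two_apply]
  simp
  ring_nf

/-- A positive subharmonic function of 2-obtuse growth around the origin is constant; here the
integrals over spheres are written in polar coordinates. -/
lemma exists_eq_const_of_lintegral_inv_eq_top (hn : 1 ≤ n) (hu : ContDiff ℝ 2 u)
    (hpos : ∀ x, 0 < u x) (hsub : ∀ x, 0 ≤ euclideanLaplacian u x) {q : ℝ} (hq : 1 < q)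
    (hgrowth : ∀ a : ℝ, 0 < a →
      ∫⁻ r in Ioi a, (ENNReal.ofReal (r ^ (n - 1) *
        ∫ ω : sphere (0 : EuclideanSpace ℝ (Fin n)) 1, u (r • ω.1) ^ q
          ∂(volume : Measure (EuclideanSpace ℝ (Fin n))).toSphere))⁻¹ = ⊤) :
    ∃ c : ℝ, ∀ x, u x = c := by
  have hdim : finrank ℝ (EuclideanSpace ℝ (Fin n)) = n := finrank_euclideanSpace_fin
  have : Nontrivial (EuclideanSpace ℝ (Fin n)) :=
    Module.nontrivial_of_finrank_pos (R := ℝ) (by omega)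
  set σ : Measure (sphere (0 : EuclideanSpace ℝ (Fin n)) 1) :=
    (volume : Measure (EuclideanSpace ℝ (Fin n))).toSphere
  have hq1 : 0 < q - 1 := sub_pos.2 hq
  set X : Fin n → EuclideanSpace ℝ (Fin n) → ℝ := fun i x ↦
    u x ^ (q - 1) * fderiv ℝ u x (EuclideanSpace.single i 1)
  have hX : ∀ i, ContDiff ℝ 1 (X i) := fun i ↦
    ((hu.of_le one_le_two).rpow_const_of_ne fun x ↦ (hpos x).ne').mul
      ((hu.fderiv_right (m := 1) le_rfl).clm_apply contDiff_const)
  have hXc : ∀ i, Continuous (X i) := fun i ↦ (hX i).continuous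
  set D : EuclideanSpace ℝ (Fin n) → ℝ := fun x ↦
    ∑ i, fderiv ℝ (X i) x (EuclideanSpace.single i 1)
  have hDc : Continuous D := continuous_finsetSum _ fun i _ ↦
    ((hX i).continuous_fderiv one_ne_zero).clm_apply continuous_const
  have hD : ∀ x, (q - 1) * (u x ^ (q - 2) *
      ∑ i, fderiv ℝ u x (EuclideanSpace.single i 1) ^ 2) ≤ D x := by
    intro x
    have e : D x = (q - 1) * (u x ^ (q - 2) *
        ∑ i, fderiv ℝ u x (EuclideanSpace.single i 1) ^ 2) +
          u x ^ (q - 1) * euclideanLaplacian u x := by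
      simp only [D, X, fderiv_rpow_mul_fderiv_single hu hpos, Finset.sum_add_distrib,
        euclideanLaplacian, Finset.mul_sum, mul_assoc]
    rw [e]
    have := mul_nonneg (Real.rpow_nonneg (hpos x).le (q - 1)) (hsub x)
    linarith
  have hgrad : ∀ x, 0 ≤ u x ^ (q - 2) * ∑ i, fderiv ℝ u x (EuclideanSpace.single i 1) ^ 2 :=
    fun x ↦ mul_nonneg (Real.rpow_nonneg (hpos x).le _) (Finset.sum_nonneg fun i _ ↦ sq_nonneg _)
  have hD0 : ∀ x, 0 ≤ D x := fun x ↦ (mul_nonneg hq1.le (hgrad x)).trans (hD x)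
  have hintegrable : ∀ g : sphere (0 : EuclideanSpace ℝ (Fin n)) 1 → ℝ, Continuous g →
      Integrable g σ := fun g hg ↦
    hg.integrable_of_hasCompactSupport (HasCompactSupport.of_compactSpace g)
  have huq : Continuous fun x ↦ u x ^ q := hu.continuous.rpow_const fun x ↦ Or.inl (hpos x).ne'
  set A : ℝ → ℝ := fun r ↦ r ^ (n - 1) * ∫ ω, D (r • ω.1) ∂σ
  have hA : Continuous A := continuous_pow_mul_integral_toSphere volume _
    (hDc.comp (by fun_prop : Continuous fun p : ℝ × sphere (0 : EuclideanSpace ℝ (Fin n)) 1 ↦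
      p.1 • p.2.1))
  have hA0 : ∀ r, 0 ≤ r → 0 ≤ A r := fun r hr ↦
    mul_nonneg (pow_nonneg hr _) (integral_nonneg fun ω ↦ hD0 _)
  set F : ℝ → ℝ := fun r ↦ ∫ s in (0 : ℝ)..r, A s
  have hF : ∀ r, HasDerivAt F (A r) r := fun r ↦ (hA.integral_hasStrictDerivAt 0 r).hasDerivAt
  have hflux : ∀ r, 0 < r → r ^ (n - 1) * ∫ ω, ∑ i, ω.1 i * X i (r • ω.1) ∂σ = F r :=
    fun r hr ↦ flux_toSphere_eq_integral_divergence hn hX hr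
  have hF0 : ∀ r, 0 < r → F r = 0 := by
    intro a ha
    refine le_antisymm (le_of_not_gt fun hFa ↦ ?_)
      (intervalIntegral.integral_nonneg ha.le fun r hr ↦ hA0 r hr.1)
    refine (lintegral_Ioi_inv_lt_top_of_sq_le hF hA (fun r hr ↦ hA0 r hr.le) (fun r hr ↦ mul_nonneg
      (pow_nonneg hr.le (n - 1)) (integral_nonneg fun ω ↦ Real.rpow_nonneg (hpos _).le _))
      hq1 (fun r hr ↦ ?_) ha hFa).ne (hgrowth a ha)
    have hCS := sq_integral_le_integral_mul_integral (μ := σ)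
      (b := fun ω ↦ ∑ i, ω.1 i * X i (r • ω.1)) (p := fun ω ↦ u (r • ω.1) ^ q)
      (d := fun ω ↦ D (r • ω.1) / (q - 1)) (hintegrable _ (by fun_prop))
      (hintegrable _ (huq.comp (by fun_prop))) (hintegrable _ (by fun_prop))
      (fun ω ↦ Real.rpow_nonneg (hpos _).le _) (fun ω ↦ div_nonneg (hD0 _) hq1.le) fun ω ↦ ?_
    · rw [integral_div, ← mul_div_assoc, le_div_iff₀ hq1] at hCS
      rw [← hflux r hr, mul_pow]
      calc (q - 1) * ((r ^ (n - 1)) ^ 2 * (∫ ω, ∑ i, ω.1 i * X i (r • ω.1) ∂σ) ^ 2)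
          = (r ^ (n - 1)) ^ 2 *
              ((∫ ω, ∑ i, ω.1 i * X i (r • ω.1) ∂σ) ^ 2 * (q - 1)) := by ring
        _ ≤ (r ^ (n - 1)) ^ 2 *
              ((∫ ω, u (r • ω.1) ^ q ∂σ) * ∫ ω, D (r • ω.1) ∂σ) := by gcongr
        _ = _ := by ring
    · set x := r • ω.1
      have hω : ∑ i, ω.1 i ^ 2 = 1 := by
        rw [← EuclideanSpace.real_norm_sq_eq]
        simp
      have hpow : (u x ^ (q - 1)) ^ 2 = u x ^ q * u x ^ (q - 2) := by
        rw [← Real.rpow_natCast, ← Real.rpow_mul (hpos x).le, ← Real.rpow_add (hpos x)]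
        congr 1
        push_cast
        ring
      calc (∑ i, ω.1 i * X i x) ^ 2 ≤ (∑ i, ω.1 i ^ 2) * ∑ i, X i x ^ 2 :=
            Finset.sum_mul_sq_le_sq_mul_sq _ _ _
        _ = u x ^ q * (u x ^ (q - 2) *
              ∑ i, fderiv ℝ u x (EuclideanSpace.single i 1) ^ 2) := by
            simp only [hω, one_mul, X, mul_pow, ← Finset.mul_sum, hpow, mul_assoc]
        _ ≤ u x ^ q * (D x / (q - 1)) := by
            refine mul_le_mul_of_nonneg_left ?_ (Real.rpow_nonneg (hpos x).le _)
            rw [le_div_iff₀ hq1, mul_comm]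
            exact hD x
  have hDz : ∀ x, x ≠ 0 → D x = 0 := by
    intro x hx
    have hr : 0 < ‖x‖ := norm_pos_iff.2 hx
    have hAz : A ‖x‖ = 0 := by
      have h := (hF ‖x‖).congr_of_eventuallyEq (f₁ := fun _ ↦ (0 : ℝ))
        (by filter_upwards [lt_mem_nhds hr] with r hr using (hF0 r hr).symm)
      exact h.unique (hasDerivAt_const _ _)
    have hint : ∫ ω, D (‖x‖ • ω.1) ∂σ = 0 :=
      (mul_eq_zero.1 hAz).resolve_left (pow_pos hr _).ne'
    have hc : Continuous fun ω : sphere (0 : EuclideanSpace ℝ (Fin n)) 1 ↦ D (‖x‖ • ω.1) := by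
      fun_prop
    rw [integral_eq_zero_iff_of_nonneg (fun ω ↦ hD0 _) (hintegrable _ hc)] at hint
    have := congrFun (Measure.eq_of_ae_eq hint hc continuous_const)
      ⟨‖x‖⁻¹ • x, by simp [norm_smul, hr.ne']⟩
    simpa [smul_smul, hr.ne'] using this
  have hfz : ∀ x ∈ ({0}ᶜ : Set (EuclideanSpace ℝ (Fin n))), fderiv ℝ u x = 0 := by
    intro x hx
    have h1 := hD x
    rw [hDz x hx] at h1
    have h2 : ∑ i, fderiv ℝ u x (EuclideanSpace.single i 1) ^ 2 = 0 := by
      have h3 := le_antisymm (nonpos_of_mul_nonpos_right h1 hq1) (hgrad x)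
      exact (mul_eq_zero.1 h3).resolve_left (Real.rpow_pos_of_pos (hpos x) _).ne'
    rw [Finset.sum_eq_zero_iff_of_nonneg fun i _ ↦ sq_nonneg _] at h2
    refine ContinuousLinearMap.coe_injective
      ((EuclideanSpace.basisFun (Fin n) ℝ).toBasis.ext fun i ↦ ?_)
    simpa using h2 i (Finset.mem_univ i)
  have hfz' : fderiv ℝ u = fun _ ↦ 0 :=
    Continuous.ext_on (dense_compl_singleton 0) (hu.continuous_fderiv two_ne_zero)
      continuous_const hfz
  exact ⟨u 0, fun x ↦ is_const_of_fderiv_eq_zero (hu.differentiable two_ne_zero)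
    (fun x ↦ congrFun hfz' x) x 0⟩

end Growth

/-- A positive `C²` function on `ℝⁿ` with `Δf ≥ 0` everywhere which has 2-obtuse growth
with respect to some `q > 1` (i.e. there is `x₀` such that for every `a > 0`,
`∫_a^∞ (∫_{∂B(x₀;r)} f^q dσ)⁻¹ dr = ∞`, where `dσ` is the `(n−1)`-dimensional Hausdorff
measure on the sphere `∂B(x₀;r)`) must be constant. -/
theorem euclidean_subharmonic_two_obtuse_growth_constant
    {n : ℕ} (hn : 1 ≤ n) (f : EuclideanSpace ℝ (Fin n) → ℝ)
    (hf_pos : ∀ x, 0 < f x) (hf_C2 : ContDiff ℝ 2 f)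
    (hf_sub : ∀ x, 0 ≤ euclideanLaplacian f x)
    (q : ℝ) (hq : 1 < q) (x₀ : EuclideanSpace ℝ (Fin n))
    (hgrowth : ∀ a : ℝ, 0 < a →
      (∫⁻ r in Set.Ioi a,
        (∫⁻ x in Metric.sphere x₀ r, ENNReal.ofReal (f x ^ q) ∂(μH[(n : ℝ) - 1]))⁻¹) = ⊤) :
    ∃ c : ℝ, ∀ x, f x = c := by
  have hdim : Module.finrank ℝ (EuclideanSpace ℝ (Fin n)) = n := finrank_euclideanSpace_fin
  obtain ⟨C, hC0, hCt, hC⟩ := exists_lintegral_toSphere_le_lintegral_hausdorffMeasure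
    (volume : Measure (EuclideanSpace ℝ (Fin n))) (by rwa [hdim])
  rw [hdim] at hC
  have hfq : Continuous fun x ↦ f x ^ q :=
    hf_C2.continuous.rpow_const fun x ↦ Or.inl (hf_pos x).ne'
  obtain ⟨c, hc⟩ := exists_eq_const_of_lintegral_inv_eq_top (u := fun x ↦ f (x₀ + x)) hn
    (hf_C2.comp (contDiff_const.add contDiff_id)) (fun x ↦ hf_pos _)
    (fun x ↦ by
      simpa only [euclideanLaplacian, iteratedFDeriv_comp_add_left] using hf_sub (x₀ + x))
    hq fun a ha ↦ by
      by_contra hfin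
      refine (ENNReal.mul_lt_top hCt.lt_top (lt_top_iff_ne_top.2 hfin)).ne
        (top_le_iff.1 ((hgrowth a ha).ge.trans ?_))
      rw [← lintegral_const_mul' _ _ hCt]
      refine setLIntegral_mono' measurableSet_Ioi fun r hr ↦ ?_
      have hr0 : 0 < r := ha.trans hr
      have h := hC x₀ r hr0 (fun x ↦ ENNReal.ofReal (f x ^ q)) hfq.measurable.ennreal_ofReal
      have hcont : Continuous fun ω : Metric.sphere (0 : EuclideanSpace ℝ (Fin n)) 1 ↦
        f (x₀ + r • ω.1) ^ q := hfq.comp (by fun_prop)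
      rw [← ENNReal.ofReal_pow hr0.le, ← ofReal_integral_eq_lintegral_ofReal
        (hcont.integrable_of_hasCompactSupport (HasCompactSupport.of_compactSpace _))
        (Eventually.of_forall fun ω ↦ Real.rpow_nonneg (hf_pos _).le _),
        ← ENNReal.ofReal_mul (by positivity)] at h
      calc (∫⁻ x in Metric.sphere x₀ r, ENNReal.ofReal (f x ^ q) ∂μH[(n : ℝ) - 1])⁻¹
          = C * (C * ∫⁻ x in Metric.sphere x₀ r, ENNReal.ofReal (f x ^ q) ∂μH[(n : ℝ) - 1])⁻¹ := by
            rw [ENNReal.mul_inv (Or.inl hC0) (Or.inl hCt), ← mul_assoc,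
              ENNReal.mul_inv_cancel hC0 hCt, one_mul]
        _ ≤ _ := by
            gcongr
  exact ⟨c, fun x ↦ by simpa using hc (x - x₀)⟩
end

section
/- Let n ≥ 1 and let f : ℝⁿ → ℝ be a positive C² function with Δf ≥ 0 everywhere. Suppose there exist a real number q > 1 and a point x₀ ∈ ℝⁿ such that for every a > 0 one has ∫_a^∞ r · ( ∫_{B(x₀;r)} f^q dx )^{−1} dr = ∞ (i.e. f has 2-small growth with respect to q). Then f is constant. -/
open MeasureTheory Filter

section Caccioppoli

variable {E : Type*} [NormedAddCommGroup E] [NormedSpace ℝ E] [FiniteDimensional ℝ E]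
  [MeasurableSpace E] [BorelSpace E] (μ : Measure E) [μ.IsAddHaarMeasure]

/-- Directional Caccioppoli inequality for a positive `C²` function. Summing it over an orthonormal
basis turns the second term on the left into the integral of `ψ² f ^ (q - 1) Δf`. -/
theorem caccioppoli_directional {f ψ : E → ℝ} (hf_pos : ∀ x, 0 < f x) (hf : ContDiff ℝ 2 f)
    (hψ : ContDiff ℝ 1 ψ) (hψ_supp : HasCompactSupport ψ) {q : ℝ} (hq : 1 < q) (e : E) :
    (q - 1) / 2 * ∫ x, ψ x ^ 2 * (f x ^ (q - 2) * fderiv ℝ f x e ^ 2) ∂μ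
      + ∫ x, ψ x ^ 2 * (f x ^ (q - 1) * fderiv ℝ (fun y => fderiv ℝ f y e) x e) ∂μ
      ≤ 2 / (q - 1) * ∫ x, f x ^ q * fderiv ℝ ψ x e ^ 2 ∂μ := by
  have hg : ContDiff ℝ 1 (fun y => fderiv ℝ f y e) :=
    (hf.fderiv_right (m := 1) (by norm_num)).clm_apply contDiff_const
  have hf1 : ContDiff ℝ 1 f := hf.of_le (by norm_num)
  have hpow (s : ℝ) : ContDiff ℝ 1 (fun y => f y ^ s) :=
    hf1.rpow_const_of_ne fun x => (hf_pos x).ne'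
  have hψc := hψ.continuous
  have hgc := hg.continuous
  have hg'c : Continuous fun x => fderiv ℝ (fun y => fderiv ℝ f y e) x e :=
    (hg.continuous_fderiv (by norm_num)).clm_apply continuous_const
  have hψ'c : Continuous fun x => fderiv ℝ ψ x e :=
    (hψ.continuous_fderiv (by norm_num)).clm_apply continuous_const
  have hpc (s : ℝ) : Continuous fun x => f x ^ s := (hpow s).continuous
  have hint {h : E → ℝ} (hh : Continuous h) : Integrable (fun x => ψ x * h x) μ :=
    (hψc.mul hh).integrable_of_hasCompactSupport hψ_supp.mul_right
  set v : E → ℝ := fun x => ψ x ^ 2 * f x ^ (q - 1)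
  have hv : ContDiff ℝ 1 v := (hψ.pow 2).mul (hpow _)
  have hv' (x : E) : fderiv ℝ v x e = 2 * ψ x * fderiv ℝ ψ x e * f x ^ (q - 1)
      + (q - 1) * ψ x ^ 2 * f x ^ (q - 2) * fderiv ℝ f x e := by
    have h1 := (hψ.differentiable (by norm_num) x).hasFDerivAt
    have h2 := (hf1.differentiable (by norm_num) x).hasFDerivAt
    have h3 := ((h1.pow 2).mul (h2.rpow_const (p := q - 1) (Or.inl (hf_pos x).ne'))).fderiv
    have : fderiv ℝ v x = _ := h3
    rw [this]
    simp [show q - 1 - 1 = q - 2 by ring]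
    ring
  have hI1 : Integrable (fun x => ψ x ^ 2 * (f x ^ (q - 2) * fderiv ℝ f x e ^ 2)) μ := by
    simpa only [pow_two, mul_assoc] using hint (hψc.fun_mul ((hpc (q - 2)).fun_mul (hgc.fun_mul hgc)))
  have hI2 : Integrable (fun x => ψ x * (fderiv ℝ ψ x e * f x ^ (q - 1) * fderiv ℝ f x e)) μ :=
    hint ((hψ'c.mul (hpc _)).mul hgc)
  have hI3 : Integrable (fun x => f x ^ q * fderiv ℝ ψ x e ^ 2) μ := by
    refine ((hpc q).mul (hψ'c.pow 2)).integrable_of_hasCompactSupport ?_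
    have : HasCompactSupport fun x => fderiv ℝ ψ x e := hψ_supp.fderiv_apply ℝ e
    refine HasCompactSupport.mul_left ?_
    simpa only [pow_two] using this.mul_right
  have hparts : ∫ x, ψ x ^ 2 * (f x ^ (q - 1) * fderiv ℝ (fun y => fderiv ℝ f y e) x e) ∂μ
      = - ∫ x, fderiv ℝ v x e * fderiv ℝ f x e ∂μ := by
    rw [← integral_mul_fderiv_eq_neg_fderiv_mul_of_integrable]
    · simp only [v, mul_assoc]
    · refine ((hI2.const_mul 2).add (hI1.const_mul (q - 1))).congr (.of_forall fun x => ?_)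
      simp only [Pi.add_apply, hv']
      ring
    · refine (hint (hψc.fun_mul ((hpc (q - 1)).fun_mul hg'c))).congr (.of_forall fun x => ?_)
      simp only [v]
      ring
    · refine (hint (hψc.fun_mul ((hpc (q - 1)).fun_mul hgc))).congr (.of_forall fun x => ?_)
      simp only [v]
      ring
    · exact fun x _ => hv.differentiable (by norm_num) x
    · exact fun x _ => hg.differentiable (by norm_num) x
  rw [hparts, ← integral_const_mul, ← integral_const_mul, ← sub_eq_add_neg, sub_le_iff_le_add]
  have hI4 : Integrable (fun x => fderiv ℝ v x e * fderiv ℝ f x e) μ := by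
    refine ((hI2.const_mul 2).add (hI1.const_mul (q - 1))).congr (.of_forall fun x => ?_)
    simp only [Pi.add_apply, hv']
    ring
  rw [← integral_add (hI3.const_mul _) hI4]
  refine integral_mono (hI1.const_mul _) ((hI3.const_mul _).add hI4) fun x => ?_
  have hq' : 0 < q - 1 := by linarith
  have hp1 : f x ^ (q - 1) = f x ^ (q - 2) * f x := by
    rw [← Real.rpow_add_one (hf_pos x).ne']
    ring_nf
  have hp2 : f x ^ q = f x ^ (q - 2) * f x ^ 2 := by
    rw [← Real.rpow_add_natCast (hf_pos x).ne']
    norm_num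
  have hp : 0 ≤ f x ^ (q - 2) := Real.rpow_nonneg (hf_pos x).le _
  have hsq := mul_nonneg (div_nonneg hp (by linarith : 0 ≤ 2 * (q - 1)))
    (sq_nonneg (2 * f x * fderiv ℝ ψ x e + (q - 1) * ψ x * fderiv ℝ f x e))
  simp only [hv', hp1, hp2]
  rw [← sub_nonneg]
  convert hsq using 1
  field_simp
  ring

end Caccioppoli

section Cutoff

theorem sq_sum_of_pairwise_mul_eq_zero {ι R : Type*} [CommSemiring R] (s : Finset ι) (a : ι → R)
    (h : ∀ i j, i ≠ j → a i * a j = 0) : (∑ i ∈ s, a i) ^ 2 = ∑ i ∈ s, a i ^ 2 := by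
  rw [pow_two, Finset.sum_mul_sum]
  refine Finset.sum_congr rfl fun i hi => ?_
  rw [Finset.sum_eq_single_of_mem i hi fun j _ hj => h i j hj.symm, pow_two]

variable {E : Type*} [NormedAddCommGroup E] [InnerProductSpace ℝ E] [FiniteDimensional ℝ E]

/-- A smooth function equal to `1` on the unit ball and to `0` outside the ball of radius `2`,
rescaled to the balls of radii `r` and `2 * r` around `x₀`. -/
theorem exists_annular_cutoff (x₀ : E) : ∃ C : ℝ, 0 < C ∧ ∀ r : ℝ, 0 < r → ∃ χ : E → ℝ,
    ContDiff ℝ 1 χ ∧ HasCompactSupport χ ∧ (∀ x ∈ Metric.closedBall x₀ r, χ x = 1) ∧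
    (∀ x, fderiv ℝ χ x ≠ 0 → r < dist x x₀ ∧ dist x x₀ < 2 * r) ∧
    ∀ x, ‖fderiv ℝ χ x‖ ≤ C / r := by
  let b : ContDiffBump (0 : E) := ⟨1, 2, one_pos, one_lt_two⟩
  have hb : ContDiff ℝ 1 b := b.contDiff
  obtain ⟨C, hC⟩ := (b.hasCompactSupport.fderiv ℝ).exists_bound_of_continuous
    (hb.continuous_fderiv (by norm_num))
  refine ⟨max C 1, by positivity, fun r hr => ⟨fun x => b (r⁻¹ • (x - x₀)), ?_, ?_, ?_, ?_, ?_⟩⟩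
  · exact hb.comp ((contDiff_id.sub contDiff_const).const_smul _)
  · refine HasCompactSupport.of_support_subset_isCompact (isCompact_closedBall x₀ (2 * r))
      fun x hx => ?_
    by_contra hn
    refine hx (b.zero_of_le_dist ?_)
    rw [Metric.mem_closedBall, dist_eq_norm, not_le] at hn
    rw [dist_zero_right, norm_smul, norm_inv, Real.norm_of_nonneg hr.le, ← div_eq_inv_mul,
      le_div_iff₀ hr]
    exact hn.le
  · intro x hx
    refine b.one_of_mem_closedBall ?_
    rw [Metric.mem_closedBall, dist_eq_norm] at hx
    rw [mem_closedBall_zero_iff, norm_smul, norm_inv, Real.norm_of_nonneg hr.le, ← div_eq_inv_mul,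
      div_le_iff₀ hr]
    simpa [b] using hx
  · intro x hx
    by_contra hn
    rw [not_and_or, not_lt, not_lt] at hn
    refine hx ?_
    rcases hn with hn | hn
    · refine IsLocalMax.fderiv_eq_zero (.of_forall fun y => ?_)
      have : b (r⁻¹ • (x - x₀)) = 1 := by
        refine b.one_of_mem_closedBall ?_
        rw [dist_eq_norm] at hn
        rw [mem_closedBall_zero_iff, norm_smul, norm_inv, Real.norm_of_nonneg hr.le,
          ← div_eq_inv_mul, div_le_iff₀ hr]
        simpa [b] using hn
      simpa only [this] using b.le_one
    · refine IsLocalMin.fderiv_eq_zero (.of_forall fun y => ?_)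
      have : b (r⁻¹ • (x - x₀)) = 0 := by
        refine b.zero_of_le_dist ?_
        rw [dist_eq_norm] at hn
        rw [dist_zero_right, norm_smul, norm_inv, Real.norm_of_nonneg hr.le, ← div_eq_inv_mul,
          le_div_iff₀ hr]
        exact hn
      simpa only [this] using b.nonneg
  · intro x
    have h1 : HasFDerivAt (fun y : E => r⁻¹ • (y - x₀)) (r⁻¹ • ContinuousLinearMap.id ℝ E) x :=
      ((hasFDerivAt_id x).sub_const x₀).const_smul r⁻¹
    have h2 := ((hb.differentiable (by norm_num) (r⁻¹ • (x - x₀))).hasFDerivAt.comp x h1).fderiv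
    have h3 : fderiv ℝ (fun y : E => b (r⁻¹ • (y - x₀))) x = _ := h2
    rw [h3, ContinuousLinearMap.comp_smul, ContinuousLinearMap.comp_id, norm_smul, norm_inv,
      Real.norm_of_nonneg hr.le, ← div_eq_inv_mul]
    exact div_le_div_of_nonneg_right ((hC _).trans (le_max_left _ _)) hr.le

variable [MeasurableSpace E] [BorelSpace E] (μ : Measure E) [μ.IsAddHaarMeasure]

theorem setIntegral_ball_pos {w : E → ℝ} (hw : Continuous w) (hw_pos : ∀ x, 0 < w x) (x₀ : E)
    {r : ℝ} (hr : 0 < r) : 0 < ∫ x in Metric.ball x₀ r, w x ∂μ := by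
  have hint : IntegrableOn w (Metric.ball x₀ r) μ :=
    (hw.continuousOn.integrableOn_compact (isCompact_closedBall x₀ r)).mono_set
      Metric.ball_subset_closedBall
  rw [setIntegral_pos_iff_support_of_nonneg_ae (.of_forall fun x => (hw_pos x).le) hint]
  have : Function.support w = Set.univ := Set.eq_univ_of_forall fun x => (hw_pos x).ne'
  rw [this, Set.univ_inter]
  exact Metric.measure_ball_pos μ x₀ hr

/-- If `∫ r / V(r) dr` diverges, where `V(r)` is the mass of the ball of radius `r`, then so does
the corresponding dyadic series. -/
theorem not_summable_dyadic_of_lintegral_eq_top {w : E → ℝ} (hw : Continuous w)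
    (hw_pos : ∀ x, 0 < w x) (x₀ : E) (m : ℕ)
    (hgrowth : (∫⁻ r in Set.Ioi ((2 : ℝ) ^ (m + 1)),
      ENNReal.ofReal r * (∫⁻ x in Metric.ball x₀ r, ENNReal.ofReal (w x) ∂μ)⁻¹) = ⊤) :
    ¬ Summable fun k : ℕ => (2 ^ (m + k)) ^ 2 / ∫ x in Metric.ball x₀ (2 * 2 ^ (m + k)), w x ∂μ := by
  set b : ℕ → ℝ := fun k => (2 ^ (m + k)) ^ 2 / ∫ x in Metric.ball x₀ (2 * 2 ^ (m + k)), w x ∂μ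
  intro hb
  refine (hb.mul_left 8).tsum_ofReal_ne_top (top_unique ?_)
  rw [← hgrowth]
  have hcover : Set.Ioi ((2 : ℝ) ^ (m + 1)) ⊆
      ⋃ k : ℕ, Set.Ioc (2 * 2 ^ (m + k)) (2 * (2 * 2 ^ (m + k))) := by
    intro r hr
    have hmono : Monotone fun k : ℕ => (2 : ℝ) * 2 ^ (m + k) := fun i j hij => by
      dsimp only
      gcongr
      norm_num
    have hr' : (2 : ℝ) * 2 ^ (m + 0) < r := by
      simpa [pow_succ, mul_comm] using hr
    obtain ⟨N, hN⟩ := pow_unbounded_of_one_lt r (one_lt_two : (1 : ℝ) < 2)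
    have hex : ∃ k : ℕ, r ≤ 2 * 2 ^ (m + k) := by
      refine ⟨N, hN.le.trans ?_⟩
      rw [← pow_succ']
      exact pow_le_pow_right₀ one_le_two (by omega)
    have hpos : Nat.find hex ≠ 0 := fun h0 => by
      have := Nat.find_spec hex
      rw [h0] at this
      linarith
    obtain ⟨k, hk⟩ := Nat.exists_eq_succ_of_ne_zero hpos
    refine Set.mem_iUnion.2 ⟨k, ?_, ?_⟩
    · exact not_le.1 (Nat.find_min hex (by omega : k < Nat.find hex))
    · have := Nat.find_spec hex
      rw [hk, Nat.succ_eq_add_one, ← add_assoc, pow_succ'] at this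
      exact this
  refine (lintegral_mono_set hcover).trans ((lintegral_iUnion_le _ _).trans ?_)
  refine ENNReal.tsum_le_tsum fun k => ?_
  set R : ℝ := 2 ^ (m + k) with hR_def
  have hR : 0 < R := by positivity
  have hV := setIntegral_ball_pos μ hw hw_pos x₀ (by positivity : 0 < 2 * R)
  have hVeq : ∫⁻ x in Metric.ball x₀ (2 * R), ENNReal.ofReal (w x) ∂μ
      = ENNReal.ofReal (∫ x in Metric.ball x₀ (2 * R), w x ∂μ) := by
    rw [ofReal_integral_eq_lintegral_ofReal]
    · exact (hw.continuousOn.integrableOn_compact (isCompact_closedBall x₀ _)).mono_set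
        Metric.ball_subset_closedBall
    · exact .of_forall fun x => (hw_pos x).le
  calc ∫⁻ r in Set.Ioc (2 * R) (2 * (2 * R)),
        ENNReal.ofReal r * (∫⁻ x in Metric.ball x₀ r, ENNReal.ofReal (w x) ∂μ)⁻¹
      ≤ ∫⁻ _ in Set.Ioc (2 * R) (2 * (2 * R)), ENNReal.ofReal (2 * (2 * R)) *
          (∫⁻ x in Metric.ball x₀ (2 * R), ENNReal.ofReal (w x) ∂μ)⁻¹ := by
        refine setLIntegral_mono' measurableSet_Ioc fun r hr => ?_
        gcongr
        · exact hr.2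
        · exact hr.1.le
    _ = ENNReal.ofReal (8 * b k) := by
        rw [hVeq, setLIntegral_const, Real.volume_Ioc, ← ENNReal.ofReal_inv_of_pos hV,
          ← ENNReal.ofReal_mul (by positivity), ← ENNReal.ofReal_mul (by positivity)]
        congr 1
        simp only [b, ← hR_def]
        ring

/-- A weight of 2-small growth has vanishing 2-capacity: there are cutoff functions of arbitrarily
small weighted Dirichlet energy. -/
theorem exists_cutoff_small_energy {w : E → ℝ} (hw : Continuous w) (hw_pos : ∀ x, 0 < w x)
    (x₀ : E) (hgrowth : ∀ a : ℝ, 0 < a → (∫⁻ r in Set.Ioi a,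
      ENNReal.ofReal r * (∫⁻ x in Metric.ball x₀ r, ENNReal.ofReal (w x) ∂μ)⁻¹) = ⊤)
    (R : ℝ) {ε : ℝ} (hε : 0 < ε) :
    ∃ ψ : E → ℝ, ContDiff ℝ 1 ψ ∧ HasCompactSupport ψ ∧ (∀ x ∈ Metric.closedBall x₀ R, ψ x = 1) ∧
      ∀ e : E, ‖e‖ ≤ 1 → ∫ x, w x * fderiv ℝ ψ x e ^ 2 ∂μ ≤ ε := by
  obtain ⟨C, hC, hχ⟩ := exists_annular_cutoff x₀
  obtain ⟨m, hm⟩ := pow_unbounded_of_one_lt R (one_lt_two : (1 : ℝ) < 2)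
  have hρ (k : ℕ) : (0 : ℝ) < 2 ^ (m + k) := by positivity
  choose χ hχ1 hχ2 hχ3 hχ4 hχ5 using fun k : ℕ => hχ (2 ^ (m + k)) (hρ k)
  set V : ℕ → ℝ := fun k => ∫ x in Metric.ball x₀ (2 * 2 ^ (m + k)), w x ∂μ with hV_def
  have hV (k : ℕ) : 0 < V k := setIntegral_ball_pos μ hw hw_pos x₀ (by positivity)
  set b : ℕ → ℝ := fun k => (2 ^ (m + k)) ^ 2 / V k with hb_def
  have hb (k : ℕ) : 0 < b k := div_pos (pow_pos (hρ k) 2) (hV k)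
  have hns : ¬ Summable b := not_summable_dyadic_of_lintegral_eq_top μ hw hw_pos x₀ m
    (hgrowth _ (by positivity))
  rw [not_summable_iff_tendsto_nat_atTop_of_nonneg fun k => (hb k).le] at hns
  obtain ⟨N, hN⟩ := (hns.eventually_ge_atTop (C ^ 2 / ε)).exists
  set S : ℝ := ∑ k ∈ Finset.range N, b k
  have hS : 0 < S := (by positivity : 0 < C ^ 2 / ε).trans_le hN
  have hψ' (x e : E) : fderiv ℝ (fun x => S⁻¹ * ∑ k ∈ Finset.range N, b k * χ k x) x e
      = S⁻¹ * ∑ k ∈ Finset.range N, b k * fderiv ℝ (χ k) x e := by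
    have h1 : HasFDerivAt (fun x => S⁻¹ * ∑ k ∈ Finset.range N, b k * χ k x)
        (S⁻¹ • ∑ k ∈ Finset.range N, b k • fderiv ℝ (χ k) x) x :=
      (HasFDerivAt.fun_sum fun k _ =>
        (((hχ1 k).differentiable (by norm_num) x).hasFDerivAt.const_mul (b k))).const_mul S⁻¹
    simp [h1.fderiv]
  have hcont (k : ℕ) (e : E) : Continuous fun x => w x * fderiv ℝ (χ k) x e ^ 2 :=
    hw.mul ((((hχ1 k).continuous_fderiv (by norm_num)).clm_apply continuous_const).pow 2)
  have hint (k : ℕ) (e : E) : Integrable (fun x => w x * fderiv ℝ (χ k) x e ^ 2) μ := by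
    refine (hcont k e).integrable_of_hasCompactSupport (HasCompactSupport.mul_left ?_)
    have : HasCompactSupport fun x => fderiv ℝ (χ k) x e := (hχ2 k).fderiv_apply ℝ e
    simp only [pow_two]
    exact this.mul_right
  have henergy (k : ℕ) (e : E) (he : ‖e‖ ≤ 1) :
      ∫ x, w x * fderiv ℝ (χ k) x e ^ 2 ∂μ ≤ (C / 2 ^ (m + k)) ^ 2 * V k := by
    rw [← setIntegral_eq_integral_of_forall_compl_eq_zero
      (s := Metric.ball x₀ (2 * 2 ^ (m + k))), hV_def, ← integral_const_mul]
    · refine setIntegral_mono_on (hint k e).integrableOn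
        (((hw.continuousOn.integrableOn_compact (isCompact_closedBall x₀ _)).mono_set
          Metric.ball_subset_closedBall).const_mul _) measurableSet_ball fun x _ => ?_
      rw [mul_comm]
      refine mul_le_mul_of_nonneg_right ?_ (hw_pos x).le
      rw [← sq_abs]
      gcongr
      calc |fderiv ℝ (χ k) x e| ≤ ‖fderiv ℝ (χ k) x‖ * ‖e‖ := (fderiv ℝ (χ k) x).le_opNorm e
        _ ≤ C / 2 ^ (m + k) * 1 := by
          gcongr
          exact hχ5 k x
        _ = C / 2 ^ (m + k) := mul_one _
    · intro x hx
      have : fderiv ℝ (χ k) x = 0 := by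
        by_contra h
        exact hx (hχ4 k x h).2
      simp [this]
  have hdisj {i j : ℕ} (hij : i < j) (x : E) : fderiv ℝ (χ i) x = 0 ∨ fderiv ℝ (χ j) x = 0 := by
    by_contra! h
    have h1 := (hχ4 i x h.1).2
    have h2 := (hχ4 j x h.2).1
    have h3 : (2 : ℝ) * 2 ^ (m + i) ≤ 2 ^ (m + j) := by
      rw [← pow_succ']
      exact pow_le_pow_right₀ one_le_two (by omega)
    linarith
  refine ⟨fun x => S⁻¹ * ∑ k ∈ Finset.range N, b k * χ k x, ?_, ?_, ?_, ?_⟩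
  · exact contDiff_const.mul (ContDiff.sum fun k _ => contDiff_const.mul (hχ1 k))
  · refine HasCompactSupport.mul_left ?_
    refine HasCompactSupport.of_support_subset_isCompact
      ((Finset.range N).isCompact_biUnion fun k _ => (hχ2 k).isCompact) fun x hx => ?_
    obtain ⟨k, hk, hne⟩ := Finset.exists_ne_zero_of_sum_ne_zero hx
    exact Set.mem_biUnion hk (subset_tsupport _ (right_ne_zero_of_mul hne))
  · intro x hx
    have hone (k : ℕ) : χ k x = 1 := hχ3 k x <| Metric.closedBall_subset_closedBall
      (hm.le.trans (pow_le_pow_right₀ one_le_two (Nat.le_add_right m k))) hx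
    simp only [hone, mul_one]
    exact inv_mul_cancel₀ hS.ne'
  · intro e he
    have hsq (x : E) : w x * (S⁻¹ * ∑ k ∈ Finset.range N, b k * fderiv ℝ (χ k) x e) ^ 2
        = S⁻¹ ^ 2 * ∑ k ∈ Finset.range N, b k ^ 2 * (w x * fderiv ℝ (χ k) x e ^ 2) := by
      rw [mul_pow, sq_sum_of_pairwise_mul_eq_zero, mul_left_comm, Finset.mul_sum]
      · congr 1
        exact Finset.sum_congr rfl fun k _ => by ring
      · intro i j hij
        rcases hij.lt_or_gt with h | h <;> rcases hdisj h x with h | h <;> simp [h]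
    simp only [hψ', hsq]
    rw [integral_const_mul, integral_finsetSum _ fun k _ => (hint k e).const_mul _]
    simp only [integral_const_mul]
    calc S⁻¹ ^ 2 * ∑ k ∈ Finset.range N, b k ^ 2 * ∫ x, w x * fderiv ℝ (χ k) x e ^ 2 ∂μ
        ≤ S⁻¹ ^ 2 * ∑ k ∈ Finset.range N, b k ^ 2 * ((C / 2 ^ (m + k)) ^ 2 * V k) := by
          gcongr with k
          exact henergy k e he
      _ = S⁻¹ ^ 2 * ∑ k ∈ Finset.range N, C ^ 2 * b k := by
          congr 1
          refine Finset.sum_congr rfl fun k _ => ?_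
          have := (hV k).ne'
          simp only [hb_def]
          field_simp
      _ = C ^ 2 / S := by
          rw [← Finset.mul_sum]
          change S⁻¹ ^ 2 * (C ^ 2 * S) = _
          field_simp
      _ ≤ ε := by
          rw [div_le_iff₀ hε] at hN
          rw [div_le_iff₀ hS]
          linarith

end Cutoff

/-- A positive `C²` function on `ℝⁿ` with `Δf ≥ 0` everywhere which has 2-small growth
with respect to some `q > 1` (i.e. there is `x₀` such that for every `a > 0`,
`∫_a^∞ r · (∫_{B(x₀;r)} f^q dx)⁻¹ dr = ∞`) must be constant. -/
theorem euclidean_subharmonic_two_small_growth_constant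
    {n : ℕ} (hn : 1 ≤ n) (f : EuclideanSpace ℝ (Fin n) → ℝ)
    (hf_pos : ∀ x, 0 < f x) (hf_C2 : ContDiff ℝ 2 f)
    (hf_sub : ∀ x, 0 ≤ euclideanLaplacian f x)
    (q : ℝ) (hq : 1 < q) (x₀ : EuclideanSpace ℝ (Fin n))
    (hgrowth : ∀ a : ℝ, 0 < a →
      (∫⁻ r in Set.Ioi a,
        ENNReal.ofReal r * (∫⁻ x in Metric.ball x₀ r, ENNReal.ofReal (f x ^ q))⁻¹) = ⊤) :
    ∃ c : ℝ, ∀ x, f x = c := by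
  have hpc (s : ℝ) : Continuous fun x => f x ^ s :=
    hf_C2.continuous.rpow_const fun x => Or.inl (hf_pos x).ne'
  have hw_pos (x : EuclideanSpace ℝ (Fin n)) : 0 < f x ^ q := Real.rpow_pos_of_pos (hf_pos x) q
  have hq' : 0 < q - 1 := by linarith
  have hzero (y : EuclideanSpace ℝ (Fin n)) (i : Fin n) :
      fderiv ℝ f y (EuclideanSpace.single i 1) = 0 := by
    let φ : ContDiffBump y := ⟨1, 2, one_pos, one_lt_two⟩
    set h : EuclideanSpace ℝ (Fin n) → ℝ :=
      fun x => f x ^ (q - 2) * fderiv ℝ f x (EuclideanSpace.single i 1) ^ 2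
    have hh_nonneg (x) : 0 ≤ h x := mul_nonneg (Real.rpow_nonneg (hf_pos x).le _) (sq_nonneg _)
    have hh : Continuous h := (hpc _).mul
      (((hf_C2.continuous_fderiv (by norm_num)).clm_apply continuous_const).pow 2)
    have hφh : Continuous fun x => φ x * h x := φ.continuous.mul hh
    have hφh_supp : HasCompactSupport fun x => φ x * h x := φ.hasCompactSupport.mul_right
    have hφh_nonneg : 0 ≤ fun x => φ x * h x := fun x => mul_nonneg φ.nonneg (hh_nonneg x)
    have hle : ∫ x, φ x * h x ≤ 0 := by
      refine le_of_forall_pos_le_add fun ε hε => ?_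
      obtain ⟨ψ, hψ, hψ_supp, hψ_one, hψ_energy⟩ := exists_cutoff_small_energy volume (hpc q) hw_pos
        x₀ hgrowth (dist y x₀ + 2) (ε := ε * (q - 1) ^ 2 / (4 * n)) (by positivity)
      set e : Fin n → EuclideanSpace ℝ (Fin n) := fun j => EuclideanSpace.single j 1
      have hg (j : Fin n) : ContDiff ℝ 1 (fun y => fderiv ℝ f y (e j)) :=
        (hf_C2.fderiv_right (m := 1) (by norm_num)).clm_apply contDiff_const
      have hint {u : EuclideanSpace ℝ (Fin n) → ℝ} (hu : Continuous u) :
          Integrable fun x => ψ x ^ 2 * u x := by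
        refine ((hψ.continuous.pow 2).mul hu).integrable_of_hasCompactSupport
          (HasCompactSupport.mul_right ?_)
        simpa only [pow_two] using hψ_supp.mul_right
      have hlap : 0 ≤ ∑ j, ∫ x, ψ x ^ 2 *
          (f x ^ (q - 1) * fderiv ℝ (fun y => fderiv ℝ f y (e j)) x (e j)) := by
        rw [← integral_finsetSum _ fun j _ => hint ((hpc _).fun_mul
          (((hg j).continuous_fderiv (by norm_num)).clm_apply continuous_const))]
        refine integral_nonneg fun x => ?_
        simp only [← Finset.mul_sum]
        refine mul_nonneg (sq_nonneg _) (mul_nonneg (Real.rpow_nonneg (hf_pos x).le _) ?_)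
        refine (hf_sub x).trans_eq (Finset.sum_congr rfl fun j _ => ?_)
        rw [iteratedFDeriv_two_apply, fderiv_clm_apply
          ((hf_C2.fderiv_right (m := 1) (by norm_num)).differentiable (by norm_num) x)
          (differentiableAt_const _)]
        simp [e]
      have hsum := Finset.sum_le_sum fun j (_ : j ∈ Finset.univ) =>
        (caccioppoli_directional volume hf_pos hf_C2 hψ hψ_supp hq (e j)).trans
          (mul_le_mul_of_nonneg_left (hψ_energy (e j) (by simp [e])) (by positivity))
      rw [Finset.sum_add_distrib, ← Finset.mul_sum, Finset.sum_const, Finset.card_univ,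
        Fintype.card_fin, nsmul_eq_mul] at hsum
      have hsingle : ∫ x, φ x * h x ≤
          ∑ j, ∫ x, ψ x ^ 2 * (f x ^ (q - 2) * fderiv ℝ f x (e j) ^ 2) := by
        refine le_trans (integral_mono (hφh.integrable_of_hasCompactSupport hφh_supp)
          (hint hh) fun x => ?_) (Finset.single_le_sum (f := fun j =>
            ∫ x, ψ x ^ 2 * (f x ^ (q - 2) * fderiv ℝ f x (e j) ^ 2)) (fun j _ =>
            integral_nonneg fun x => mul_nonneg (sq_nonneg _)
              (mul_nonneg (Real.rpow_nonneg (hf_pos x).le _) (sq_nonneg _))) (Finset.mem_univ i))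
        refine mul_le_mul_of_nonneg_right ?_ (hh_nonneg x)
        rcases lt_or_ge (dist x y) 2 with hxy | hxy
        · have hx : x ∈ Metric.closedBall x₀ (dist y x₀ + 2) := by
            rw [Metric.mem_closedBall]
            linarith [dist_triangle x y x₀]
          rw [hψ_one x hx, one_pow]
          exact φ.le_one
        · rw [φ.zero_of_le_dist hxy]
          exact sq_nonneg _
      have hbound : (q - 1) / 2 * ∫ x, φ x * h x ≤ (q - 1) / 2 * ε := by
        calc (q - 1) / 2 * ∫ x, φ x * h x
            ≤ n * (2 / (q - 1) * (ε * (q - 1) ^ 2 / (4 * n))) := by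
              linarith [mul_le_mul_of_nonneg_left hsingle (by positivity : 0 ≤ (q - 1) / 2)]
          _ = (q - 1) / 2 * ε := by
              have : (n : ℝ) ≠ 0 := by positivity
              field_simp
              norm_num
      simpa using le_of_mul_le_mul_left hbound (by positivity)
    by_contra hne
    refine (hφh.integral_pos_of_hasCompactSupport_nonneg_nonzero (μ := volume) (x := y)
      hφh_supp hφh_nonneg ?_).not_ge hle
    have hφy : φ y = 1 := φ.one_of_mem_closedBall (Metric.mem_closedBall_self one_pos.le)
    simp only [hφy, one_mul, h]
    exact mul_ne_zero (Real.rpow_pos_of_pos (hf_pos y) _).ne' (pow_ne_zero 2 hne)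
  have hfd (y) : fderiv ℝ f y = 0 := by
    refine ContinuousLinearMap.coe_injective
      ((EuclideanSpace.basisFun (Fin n) ℝ).toBasis.ext fun i => ?_)
    simpa using hzero y i
  exact ⟨f x₀, fun x => is_const_of_fderiv_eq_zero (hf_C2.differentiable (by norm_num)) hfd x x₀⟩
end
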